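/- arXiv:1805.03852 — 9 statements merged into one kernel-verified Lean document; each statement's English description precedes it below -/
import Mathlib

section
/- Positive introspection fails for name-indexed knowledge over epistemic models: there exist an epistemic model M, a world w, an assignment σ, a name a, and an ELAS formula φ such that M,w,σ ⊨ K_a φ but M,w,σ ⊭ K_a K_a φ. -/
namespace ELAS

/-- Terms of ELAS: variables and names (each drawn from a denumerable set, here ℕ). -/
inductive Term : Type
  | var : ℕ → Term
  | name : ℕ → Term

/-- Formulas of ELAS. -/
inductive Formula : Type
  | eq : Term → Term → Formula
  | pred : ℕ → List Term → Formula
  | neg : Formula → Formula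
  | and : Formula → Formula → Formula
  | know : Term → Formula → Formula
  | assign : ℕ → Term → Formula → Formula

def Formula.imp (φ ψ : Formula) : Formula := .neg (.and φ (.neg ψ))
def Formula.iff (φ ψ : Formula) : Formula := .and (φ.imp ψ) (ψ.imp φ)
def Formula.top : Formula := (Formula.eq (.name 0) (.name 0)).imp (.eq (.name 0) (.name 0))
/-- ⟨x:=t⟩φ abbreviates ¬[x:=t]¬φ. -/
def Formula.dassign (x : ℕ) (t : Term) (φ : Formula) : Formula := .neg (.assign x t (.neg φ))

def Formula.conjList : List Formula → Formula
  | [] => Formula.top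
  | φ :: l => .and φ (Formula.conjList l)

def Term.vars : Term → Finset ℕ
  | .var x => {x}
  | .name _ => ∅

def Term.hasVar : Term → ℕ → Prop
  | .var x, z => x = z
  | .name _, _ => False

/-- Free variables, viewing [x:=t] as a quantifier binding x (the t is not bound). -/
def Formula.fv : Formula → Finset ℕ
  | .eq t t' => t.vars ∪ t'.vars
  | .pred _ ts => ts.foldr (fun t s => t.vars ∪ s) ∅
  | .neg φ => φ.fv
  | .and φ ψ => φ.fv ∪ ψ.fv
  | .know t φ => t.vars ∪ φ.fv
  | .assign x t φ => (φ.fv.erase x) ∪ t.vars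

def Term.subst : Term → ℕ → ℕ → Term
  | .var z, x, y => if z = x then .var y else .var z
  | .name a, _, _ => .name a

/-- φ.subst x y is φ[y/x]: substitute variable y for free occurrences of variable x. -/
def Formula.subst : Formula → ℕ → ℕ → Formula
  | .eq t t', x, y => .eq (t.subst x y) (t'.subst x y)
  | .pred P ts, x, y => .pred P (ts.map (fun t => t.subst x y))
  | .neg φ, x, y => .neg (φ.subst x y)
  | .and φ ψ, x, y => .and (φ.subst x y) (ψ.subst x y)
  | .know t φ, x, y => .know (t.subst x y) (φ.subst x y)
  | .assign z t φ, x, y =>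
    if z = x then .assign z (t.subst x y) φ
    else .assign z (t.subst x y) (φ.subst x y)

/-- φ[y/x] is admissible: every occurrence of y arising from a free occurrence of x is free. -/
def Formula.admissible : Formula → ℕ → ℕ → Prop
  | .eq _ _, _, _ => True
  | .pred _ _, _, _ => True
  | .neg φ, x, y => φ.admissible x y
  | .and φ ψ, x, y => φ.admissible x y ∧ ψ.admissible x y
  | .know _ φ, x, y => φ.admissible x y
  | .assign z _ φ, x, y => z = x ∨ ((x ∈ φ.fv → z ≠ y) ∧ φ.admissible x y)

/-- Variable z occurs (free or bound, anywhere) in φ. -/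
def Formula.occurs : Formula → ℕ → Prop
  | .eq t t', z => t.hasVar z ∨ t'.hasVar z
  | .pred _ ts, z => ∃ t ∈ ts, t.hasVar z
  | .neg φ, z => φ.occurs z
  | .and φ ψ, z => φ.occurs z ∨ ψ.occurs z
  | .know t φ, z => t.hasVar z ∨ φ.occurs z
  | .assign x t φ, z => x = z ∨ t.hasVar z ∨ φ.occurs z

/-- The assignment-free fragment EL. -/
def Formula.inEL : Formula → Prop
  | .eq _ _ => True
  | .pred _ _ => True
  | .neg φ => φ.inEL
  | .and φ ψ => φ.inEL ∧ ψ.inEL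
  | .know _ φ => φ.inEL
  | .assign _ _ _ => False

/-- A constant-domain Kripke model for ELAS. -/
structure Model : Type 1 where
  W : Type
  I : Type
  wNE : Nonempty W
  iNE : Nonempty I
  R : I → W → W → Prop
  ρ : ℕ → W → List I → Prop
  η : ℕ → W → I

/-- Epistemic model: every accessibility relation is an equivalence relation. -/
def Model.Epistemic (M : Model) : Prop := ∀ i : M.I, Equivalence (M.R i)

/-- Denotation σ_w(t) of a term. -/
def Model.den (M : Model) (w : M.W) (σ : ℕ → M.I) : Term → M.I
  | .var x => σ x
  | .name a => M.η a w

/-- Satisfaction M,w,σ ⊨ φ. -/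
def Model.Sat (M : Model) : Formula → M.W → (ℕ → M.I) → Prop
  | .eq t t', w, σ => M.den w σ t = M.den w σ t'
  | .pred P ts, w, σ => M.ρ P w (ts.map (M.den w σ))
  | .neg φ, w, σ => ¬ M.Sat φ w σ
  | .and φ ψ, w, σ => M.Sat φ w σ ∧ M.Sat ψ w σ
  | .know t φ, w, σ => ∀ v, M.R (M.den w σ t) w v → M.Sat φ v σ
  | .assign x t φ, w, σ => M.Sat φ w (Function.update σ x (M.den w σ t))

/-- φ is an instance of a propositional tautology (treating non-Boolean formulas as atoms). -/
def isTautology (φ : Formula) : Prop :=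
  ∀ v : Formula → Prop,
    (∀ ψ, v (.neg ψ) ↔ ¬ v ψ) →
    (∀ ψ χ, v (.and ψ χ) ↔ (v ψ ∧ v χ)) →
    v φ

/-- The proof system SELAS. -/
inductive Provable : Formula → Prop
  | taut {φ : Formula} : isTautology φ → Provable φ
  | distK (t : Term) (φ ψ : Formula) :
      Provable ((Formula.know t (φ.imp ψ)).imp ((Formula.know t φ).imp (.know t ψ)))
  | tx (x : ℕ) (φ : Formula) : Provable ((Formula.know (.var x) φ).imp φ)
  | four_x (x : ℕ) (φ : Formula) :
      Provable ((Formula.know (.var x) φ).imp (.know (.var x) (.know (.var x) φ)))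
  | five_x (x : ℕ) (φ : Formula) :
      Provable ((Formula.neg (.know (.var x) φ)).imp (.know (.var x) (.neg (.know (.var x) φ))))
  | id (t : Term) : Provable (.eq t t)
  | subP (P : ℕ) (ts ts' : List Term) (h : ts.length = ts'.length) :
      Provable ((Formula.conjList (List.zipWith Formula.eq ts ts')).imp
        ((Formula.pred P ts).iff (.pred P ts')))
  | subEq (t₁ t₂ t₁' t₂' : Term) :
      Provable ((Formula.and (.eq t₁ t₁') (.eq t₂ t₂')).imp
        ((Formula.eq t₁ t₂).iff (.eq t₁' t₂')))
  | subK (t t' : Term) (φ : Formula) :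
      Provable ((Formula.eq t t').imp ((Formula.know t φ).iff (.know t' φ)))
  | subAS (t t' : Term) (x : ℕ) (φ : Formula) :
      Provable ((Formula.eq t t').imp ((Formula.assign x t φ).iff (.assign x t' φ)))
  | rigidP (x y : ℕ) (t : Term) :
      Provable ((Formula.eq (.var x) (.var y)).imp (.know t (.eq (.var x) (.var y))))
  | rigidN (x y : ℕ) (t : Term) :
      Provable ((Formula.neg (.eq (.var x) (.var y))).imp
        (.know t (.neg (.eq (.var x) (.var y)))))
  | kAS (x : ℕ) (t : Term) (φ ψ : Formula) :
      Provable ((Formula.assign x t (φ.imp ψ)).imp ((Formula.assign x t φ).imp (.assign x t ψ)))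
  | detAS (x : ℕ) (t : Term) (φ : Formula) :
      Provable ((Formula.dassign x t φ).imp (.assign x t φ))
  | dAS (x : ℕ) (t : Term) : Provable (Formula.dassign x t Formula.top)
  | efAS (x : ℕ) (t : Term) : Provable (Formula.assign x t (.eq (.var x) t))
  | sub2AS (x y : ℕ) (φ : Formula) (h : φ.admissible x y) :
      Provable ((φ.subst x y).imp (.assign x (.var y) φ))
  | mp {φ ψ : Formula} : Provable (φ.imp ψ) → Provable φ → Provable ψ
  | necK (t : Term) {φ : Formula} : Provable φ → Provable (.know t φ)
  | necAS (x : ℕ) (t : Term) {φ ψ : Formula} (h : x ∉ φ.fv) :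
      Provable (φ.imp ψ) → Provable (φ.imp (.assign x t ψ))

end ELAS

open ELAS

/-- positive introspection fails for name-indexed knowledge over
    epistemic models. -/
theorem stmt4 :
    ∃ (M : Model), M.Epistemic ∧
      ∃ (w : M.W) (σ : ℕ → M.I) (a : ℕ) (φ : Formula),
        M.Sat (.know (.name a) φ) w σ ∧
        ¬ M.Sat (.know (.name a) (.know (.name a) φ)) w σ := by
  -- Worlds 0, 1, 2; agent `true` confuses 0 and 1, agent `false` confuses 1 and 2;
  -- the name denotes `true` at world 0 and `false` elsewhere; P holds at 0 and 1 only.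
  let f : Bool → Fin 3 → Prop := fun i w => if i = true then w = 2 else w = 0
  refine ⟨{ W := Fin 3, I := Bool, wNE := ⟨0⟩, iNE := ⟨true⟩,
            R := fun i w v => f i w = f i v,
            ρ := fun _ w _ => w ≠ 2,
            η := fun _ w => decide (w = 0) }, ?_, (0 : Fin 3), fun _ => true, 0,
            .pred 0 [], ?_, ?_⟩
  · intro i
    exact ⟨fun _ => rfl, fun h => h.symm, fun h k => h.trans k⟩
  · intro v hv
    simp only [Model.Sat, Model.den] at hv ⊢
    intro h
    subst h
    simp [f] at hv
  · intro h
    have h2 := h (1 : Fin 3) (by simp [Model.den, f]) (2 : Fin 3) (by simp [Model.den, f])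
    exact h2 rfl
end

section
/- Assignment of a variable to a variable amounts to substitution: if φ[y/x] is admissible, then [x:=y]φ → φ[y/x] is valid over all constant-domain Kripke models with assignments; in fact [x:=y]φ ↔ φ[y/x] holds at every pointed model with every assignment. -/
open ELAS

theorem den_congr (M : Model) (w : M.W) (σ τ : ℕ → M.I) (t : Term)
    (h : ∀ z ∈ t.vars, σ z = τ z) : M.den w σ t = M.den w τ t := by
  cases t with
  | var z => exact h z (by simp [Term.vars])
  | name a => rfl

theorem mem_foldr_vars (ts : List Term) (t : Term) (ht : t ∈ ts) (z : ℕ) (hz : z ∈ t.vars) :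
    z ∈ ts.foldr (fun t s => t.vars ∪ s) ∅ := by
  induction ts with
  | nil => simp at ht
  | cons a l ih =>
    rw [List.foldr_cons, Finset.mem_union]
    rcases List.mem_cons.1 ht with rfl | h
    · exact Or.inl hz
    · exact Or.inr (ih h)

theorem sat_congr (M : Model) (φ : Formula) : ∀ (w : M.W) (σ τ : ℕ → M.I),
    (∀ z ∈ φ.fv, σ z = τ z) → (M.Sat φ w σ ↔ M.Sat φ w τ) := by
  induction φ with
  | eq t t' =>
    intro w σ τ h
    simp only [Formula.fv, Finset.mem_union] at h
    simp only [Model.Sat]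
    rw [den_congr M w σ τ t (fun z hz => h z (Or.inl hz)),
      den_congr M w σ τ t' (fun z hz => h z (Or.inr hz))]
  | pred P ts =>
    intro w σ τ h
    simp only [Model.Sat]
    have e : ts.map (M.den w σ) = ts.map (M.den w τ) :=
      List.map_congr_left fun t ht =>
        den_congr M w σ τ t (fun z hz => h z (mem_foldr_vars ts t ht z hz))
    rw [e]
  | neg φ ih =>
    intro w σ τ h
    simp only [Model.Sat]
    rw [ih w σ τ h]
  | and φ ψ ih1 ih2 =>
    intro w σ τ h
    simp only [Formula.fv, Finset.mem_union] at h
    simp only [Model.Sat]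
    rw [ih1 w σ τ (fun z hz => h z (Or.inl hz)), ih2 w σ τ (fun z hz => h z (Or.inr hz))]
  | know t φ ih =>
    intro w σ τ h
    simp only [Formula.fv, Finset.mem_union] at h
    simp only [Model.Sat]
    rw [den_congr M w σ τ t (fun z hz => h z (Or.inl hz))]
    exact forall_congr' fun v => imp_congr_right fun _ =>
      ih v σ τ (fun z hz => h z (Or.inr hz))
  | assign x t φ ih =>
    intro w σ τ h
    simp only [Formula.fv, Finset.mem_union, Finset.mem_erase] at h
    simp only [Model.Sat]
    rw [den_congr M w σ τ t (fun z hz => h z (Or.inr hz))]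
    apply ih
    intro z hz
    by_cases hzx : z = x
    · subst hzx; simp
    · simp only [Function.update_of_ne hzx]
      exact h z (Or.inl ⟨hzx, hz⟩)

theorem den_subst (M : Model) (w : M.W) (σ : ℕ → M.I) (x y : ℕ) (t : Term) :
    M.den w σ (t.subst x y) = M.den w (Function.update σ x (σ y)) t := by
  cases t with
  | var z =>
    by_cases hz : z = x
    · subst hz; simp [Term.subst, Model.den]
    · simp [Term.subst, Model.den, hz]
  | name a => rfl

theorem sat_subst (M : Model) (φ : Formula) (x y : ℕ) (h : φ.admissible x y) :
    ∀ (w : M.W) (σ : ℕ → M.I),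
    M.Sat φ w (Function.update σ x (σ y)) ↔ M.Sat (φ.subst x y) w σ := by
  induction φ with
  | eq t t' =>
    intro w σ
    simp only [Formula.subst, Model.Sat, den_subst]
  | pred P ts =>
    intro w σ
    have e : (ts.map (fun t => t.subst x y)).map (M.den w σ)
        = ts.map (M.den w (Function.update σ x (σ y))) := by
      rw [List.map_map]
      exact List.map_congr_left fun t _ => den_subst M w σ x y t
    simp only [Formula.subst, Model.Sat]
    rw [e]
  | neg φ ih =>
    intro w σ
    simp only [Formula.subst, Model.Sat]
    rw [ih h w σ]
  | and φ ψ ih1 ih2 =>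
    intro w σ
    simp only [Formula.subst, Model.Sat]
    rw [ih1 h.1 w σ, ih2 h.2 w σ]
  | know t φ ih =>
    intro w σ
    simp only [Formula.subst, Model.Sat, den_subst]
    exact forall_congr' fun v => imp_congr_right fun _ => ih h v σ
  | assign z t φ ih =>
    intro w σ
    by_cases hz : z = x
    · subst hz
      simp only [Formula.subst, if_true, Model.Sat, den_subst, Function.update_idem]
    · rcases h with h | ⟨h1, h2⟩
      · exact absurd h hz
      · simp only [Formula.subst, if_neg hz, Model.Sat, den_subst]
        rw [← ih h2]
        apply sat_congr
        intro u hu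
        by_cases hux : u = x
        · subst hux
          have hy : y ≠ z := fun e => h1 hu e.symm
          rw [Function.update_of_ne (Ne.symm hz), Function.update_self, Function.update_self,
            Function.update_of_ne hy]
        · by_cases huz : u = z
          · subst huz
            rw [Function.update_of_ne hux, Function.update_self, Function.update_self]
          · simp only [Function.update_of_ne hux, Function.update_of_ne huz]

/-- if φ[y/x] is admissible then [x:=y]φ ↔ φ[y/x] holds at every
    pointed constant-domain Kripke model with every assignment. -/
theorem stmt6 (φ : Formula) (x y : ℕ) (h : φ.admissible x y)
    (M : Model) (w : M.W) (σ : ℕ → M.I) :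
    M.Sat (.assign x (.var y) φ) w σ ↔ M.Sat (φ.subst x y) w σ := by
  exact sat_subst M φ x y h w σ
end

section
/- The Barcan-like schema fails for name assignments: there exist an epistemic model M, a world w, an assignment σ, names a, b, a variable x, and a unary predicate P such that M,w,σ ⊨ [x:=b]K_a P(x) but M,w,σ ⊭ K_a [x:=b] P(x); that is, [x:=b]K_a P(x) → K_a [x:=b] P(x) is not valid over epistemic models. -/
open ELAS

/-- the Barcan-like schema fails for name assignments:
    [x:=b]K_a P(x) → K_a [x:=b]P(x) is not valid over epistemic models. -/
theorem stmt9 :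
    ∃ (M : Model), M.Epistemic ∧
      ∃ (w : M.W) (σ : ℕ → M.I) (a b : ℕ) (x : ℕ) (P : ℕ),
        M.Sat (.assign x (.name b) (.know (.name a) (.pred P [.var x]))) w σ ∧
        ¬ M.Sat (.know (.name a) (.assign x (.name b) (.pred P [.var x]))) w σ := by
  refine ⟨⟨Bool, Bool, ⟨true⟩, ⟨true⟩, fun _ _ _ => True, fun _ _ l => l = [true],
    fun _ w => w⟩, ?_, true, fun _ => true, 0, 1, 0, 0, ?_, ?_⟩
  · intro i
    exact ⟨fun _ => trivial, fun _ => trivial, fun _ _ => trivial⟩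
  · intro v _
    simp [Model.Sat, Model.den]
  · intro h
    have h' := h false trivial
    simp [Model.Sat, Model.den] at h'
end

section
/- The factivity schema T is derivable in SELAS: for every term t and ELAS formula φ, ⊢ K_t φ → φ in SELAS. -/
open ELAS

theorem ELAS.Provable.nec {ψ : Formula} (z : ℕ) (t : Term) (h : Provable ψ) :
    Provable (.assign z t ψ) := by
  have h1 : Provable (Formula.top.imp ψ) := by
    refine .mp (.taut ?_) h
    intro v hn ha
    simp only [Formula.imp, hn, ha]
    tauto
  have h2 := Provable.necAS z t (φ := Formula.top)
    (by simp [Formula.top, Formula.imp, Formula.fv, Term.vars]) h1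
  refine .mp h2 (.taut ?_)
  intro v hn ha
  simp only [Formula.top, Formula.imp, hn, ha]
  tauto

/-- the factivity schema T is derivable in SELAS: ⊢ K_t φ → φ. -/
theorem stmt12 (t : Term) (φ : Formula) :
    Provable ((Formula.know t φ).imp φ) := by
  obtain ⟨z, hz⟩ := Infinite.exists_notMem_finset ((Formula.know t φ).imp φ).fv
  generalize hχ : (Formula.know t φ).imp φ = χ at hz ⊢
  -- z ≈ t → (K_t φ → φ)
  have h1 : Provable ((Formula.eq (.var z) t).imp χ) := by
    subst hχ
    refine .mp (.mp (.taut ?_) (Provable.subK (.var z) t φ)) (Provable.tx z φ)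
    intro v hn ha
    simp only [Formula.imp, Formula.iff, hn, ha]
    tauto
  have h2 : Provable (.assign z t χ) :=
    .mp (.mp (.kAS z t _ _) (h1.nec z t)) (.efAS z t)
  have h3 : Provable ((Formula.neg χ).imp (.assign z t (.neg χ))) := by
    refine .necAS z t (by simpa [Formula.fv] using hz) (.taut ?_)
    intro v hn ha
    simp only [Formula.imp, hn, ha]
    tauto
  have h4 : Provable (χ.imp ((Formula.neg χ).imp (.neg Formula.top))) := by
    refine .taut ?_
    intro v hn ha
    simp only [Formula.imp, hn, ha]
    tauto
  have h5 := Provable.mp (.kAS z t _ _) (.mp (.mp (.kAS z t _ _) (h4.nec z t)) h2)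
  refine .mp (.mp (.mp (.taut ?_) h3) h5) (.dAS z t)
  intro v hn ha
  simp only [Formula.imp, Formula.dassign, hn, ha]
  tauto
end

section
/- The substitution equivalence SUBASEQ is derivable in SELAS: for any variables x, y and ELAS formula φ such that φ[y/x] is admissible, ⊢ φ[y/x] ↔ [x:=y]φ in SELAS. -/
open ELAS

theorem ELAS.nec_taut (x : ℕ) (t : Term) {θ : Formula} (h : isTautology θ) :
    Provable (.assign x t θ) := by
  refine Provable.mp (φ := Formula.top) ?_ (Provable.taut ?_)
  · refine Provable.necAS x t (by simp [Formula.top, Formula.imp, Formula.fv, Term.vars])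
      (Provable.taut ?_)
    intro v hn ha
    have := h v hn ha
    simp only [Formula.imp, hn, ha]
    tauto
  · intro v hn ha
    simp only [Formula.top, Formula.imp, hn, ha]
    tauto

/-- SUBASEQ is derivable in SELAS: if φ[y/x] is admissible then
    ⊢ φ[y/x] ↔ [x:=y]φ. -/
theorem stmt13 (x y : ℕ) (φ : Formula) (h : φ.admissible x y) :
    Provable ((φ.subst x y).iff (.assign x (.var y) φ)) := by
  have h1 := Provable.sub2AS x y φ h
  have h2 := Provable.sub2AS x y (.neg φ) h
  have h3 : Provable (.assign x (.var y)
      ((Formula.neg φ).imp (φ.imp (.neg Formula.top)))) := by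
    apply ELAS.nec_taut
    intro v hn ha
    simp only [Formula.imp, hn, ha]
    tauto
  have h4 := Provable.mp (Provable.kAS x (.var y) _ _) h3
  have h5 := Provable.kAS x (.var y) φ (.neg Formula.top)
  have h6 := Provable.dAS x (.var y)
  refine Provable.mp (Provable.mp (Provable.mp (Provable.mp (Provable.mp
    (Provable.taut ?_) h1) h2) h4) h5) h6
  intro v hn ha
  simp only [Formula.iff, Formula.imp, Formula.dassign, Formula.subst, hn, ha]
  tauto
end

section
/- Vacuous assignments are derivably eliminable in SELAS (EAS): for any variable x, term t, and ELAS formula φ with x ∉ Fv(φ), ⊢ [x:=t]φ ↔ φ in SELAS. In particular, ⊢ [x:=x]φ ↔ φ for every formula φ (EX). -/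
namespace ELAS

theorem Term.subst_self (t : Term) (x : ℕ) : t.subst x x = t := by
  cases t with
  | var z =>
    by_cases h : z = x
    · simp [Term.subst, h]
    · simp [Term.subst, h]
  | name a => rfl

theorem Formula.subst_self (φ : Formula) (x : ℕ) : φ.subst x x = φ := by
  induction φ with
  | eq t t' => simp [Formula.subst, Term.subst_self]
  | pred P ts => simp [Formula.subst, Term.subst_self]
  | neg φ ih => simp [Formula.subst, ih]
  | and φ ψ ih ih' => simp [Formula.subst, ih, ih']
  | know t φ ih => simp [Formula.subst, Term.subst_self, ih]
  | assign z t φ ih => simp [Formula.subst, Term.subst_self, ih]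

theorem Formula.admissible_self (φ : Formula) (x : ℕ) : φ.admissible x x := by
  induction φ with
  | eq t t' => trivial
  | pred P ts => trivial
  | neg φ ih => exact ih
  | and φ ψ ih ih' => exact ⟨ih, ih'⟩
  | know t φ ih => exact ih
  | assign z t φ ih =>
    by_cases h : z = x
    · exact Or.inl h
    · exact Or.inr ⟨fun _ => h, ih⟩

/-- Necessitation for assignments. -/
theorem Provable.nec_s14 (x : ℕ) (t : Term) {φ : Formula} (h : Provable φ) :
    Provable (.assign x t φ) := by
  have h1 : Provable (Formula.top.imp φ) := by
    refine .mp (.taut ?_) h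
    intro v hn ha
    simp only [Formula.imp, hn, ha]
    tauto
  refine .mp (.necAS x t ?_ h1) (.taut ?_)
  · simp [Formula.top, Formula.imp, Formula.fv, Term.vars]
  · intro v hn ha
    simp only [Formula.top, Formula.imp, hn, ha]
    tauto

theorem Provable.iff_of (x : ℕ) (t : Term) (φ : Formula)
    (h1 : Provable (φ.imp (.assign x t φ)))
    (h2 : Provable (φ.neg.imp (.assign x t φ.neg))) :
    Provable ((Formula.assign x t φ).iff φ) := by
  have h3 : Provable (.assign x t (φ.neg.imp (φ.imp Formula.top.neg))) := by
    refine .nec x t (.taut ?_)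
    intro v hn ha
    simp only [Formula.imp, hn, ha]
    tauto
  have h4 := Provable.mp (.kAS x t _ _) h3
  have h5 := Provable.kAS x t φ Formula.top.neg
  have h6 := Provable.dAS x t
  refine .mp (.mp (.mp (.mp (.mp (.taut ?_) h1) h2) h4) h5) h6
  intro v hn ha
  simp only [Formula.dassign, Formula.iff, Formula.imp, hn, ha]
  tauto

end ELAS

open ELAS

/-- EAS is derivable in SELAS: ⊢ [x:=t]φ ↔ φ when x ∉ Fv(φ);
    in particular EX: ⊢ [x:=x]φ ↔ φ. -/
theorem stmt14 :
    (∀ (x : ℕ) (t : Term) (φ : Formula), x ∉ φ.fv →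
      Provable ((Formula.assign x t φ).iff φ)) ∧
    (∀ (x : ℕ) (φ : Formula),
      Provable ((Formula.assign x (.var x) φ).iff φ)) := by
  have hid : ∀ φ : Formula, Provable (φ.imp φ) := fun φ => .taut (by
    intro v hn ha
    simp only [Formula.imp, hn, ha]
    tauto)
  refine ⟨fun x t φ hx => .iff_of x t φ (.necAS x t hx (hid φ)) (.necAS x t hx (hid φ.neg)), ?_⟩
  intro x φ
  have key : ∀ ψ : Formula, Provable (ψ.imp (.assign x (.var x) ψ)) := by
    intro ψ
    have := Provable.sub2AS x x ψ (ψ.admissible_self x)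
    rwa [Formula.subst_self] at this
  exact .iff_of x _ φ (key φ) (key φ.neg)
end

section
/- Relettering of bound variables is derivable in SELAS: if z is a variable not occurring in φ or in the term t, then ⊢ [x:=t]φ ↔ [z:=t]φ[z/x] in SELAS. -/
namespace ELAS

theorem mp2' {a b c : Formula} (h : isTautology (a.imp (b.imp c)))
    (ha : Provable a) (hb : Provable b) : Provable c :=
  .mp (.mp (.taut h) ha) hb

theorem necAS0 (x : ℕ) (t : Term) {χ : Formula} (h : Provable χ) :
    Provable (.assign x t χ) := by
  have h1 : Provable (Formula.top.imp χ) := by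
    refine .mp (.taut ?_) h
    intro v hn ha
    simp only [Formula.imp, hn, ha]; tauto
  refine .mp (.necAS x t ?_ h1) (.taut ?_)
  · simp [Formula.top, Formula.imp, Formula.fv, Term.vars]
  · intro v hn ha
    simp only [Formula.top, Formula.imp, hn, ha]; tauto

theorem monoAS (x : ℕ) (t : Term) {φ ψ : Formula} (h : Provable (φ.imp ψ)) :
    Provable ((Formula.assign x t φ).imp (.assign x t ψ)) :=
  .mp (.kAS x t φ ψ) (necAS0 x t h)

theorem consAS (x : ℕ) (t : Term) (φ : Formula) :
    Provable ((Formula.assign x t (.neg φ)).imp (.neg (.assign x t φ))) := by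
  have h0 : Provable (φ.imp ((Formula.neg φ).imp (.neg .top))) := by
    refine .taut ?_
    intro v hn ha
    simp only [Formula.imp, hn, ha]; tauto
  have h1 := monoAS x t h0
  have h2 := Provable.kAS x t (.neg φ) (.neg .top)
  have h3 := Provable.dAS x t
  refine .mp (mp2' ?_ h1 h2) h3
  intro v hn ha
  simp only [Formula.imp, Formula.dassign, hn, ha]; tauto

theorem admissible_of_not_occurs (x z : ℕ) (φ : Formula) (h : ¬ φ.occurs z) :
    φ.admissible x z := by
  induction φ with
  | eq => trivial
  | pred => trivial
  | neg φ ih => exact ih h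
  | and φ ψ ih1 ih2 =>
    simp only [Formula.occurs, not_or] at h
    exact ⟨ih1 h.1, ih2 h.2⟩
  | know t φ ih =>
    simp only [Formula.occurs, not_or] at h
    exact ih h.2
  | assign y t φ ih =>
    simp only [Formula.occurs, not_or] at h
    exact Or.inr ⟨fun _ => h.1, ih h.2.2⟩

theorem Term.not_mem_vars (z : ℕ) (t : Term) (h : ¬ t.hasVar z) : z ∉ t.vars := by
  cases t with
  | var y => simp only [Term.hasVar] at h; simp only [Term.vars, Finset.mem_singleton]; tauto
  | name => simp [Term.vars]

theorem not_mem_fv (z : ℕ) (φ : Formula) (h : ¬ φ.occurs z) : z ∉ φ.fv := by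
  induction φ with
  | eq t t' =>
    simp only [Formula.occurs, not_or] at h
    simp [Formula.fv, Term.not_mem_vars z _ h.1, Term.not_mem_vars z _ h.2]
  | pred P ts =>
    simp only [Formula.occurs] at h
    simp only [Formula.fv]
    induction ts with
    | nil => simp
    | cons a l ih =>
      simp only [List.foldr_cons, Finset.mem_union, not_or]
      refine ⟨Term.not_mem_vars z _ fun h' => h ⟨a, by simp, h'⟩, ih ?_⟩
      rintro ⟨b, hb, hb'⟩
      exact h ⟨b, by simp [hb], hb'⟩
  | neg φ ih => exact ih h
  | and φ ψ ih1 ih2 =>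
    simp only [Formula.occurs, not_or] at h
    simp [Formula.fv, ih1 h.1, ih2 h.2]
  | know t φ ih =>
    simp only [Formula.occurs, not_or] at h
    simp [Formula.fv, ih h.2, Term.not_mem_vars z _ h.1]
  | assign y t φ ih =>
    simp only [Formula.occurs, not_or] at h
    simp [Formula.fv, ih h.2.2, Term.not_mem_vars z _ h.2.1]

theorem reletter (x z : ℕ) (t : Term) (φ : Formula)
    (hφ : ¬ φ.occurs z) (ht : ¬ t.hasVar z) :
    Provable ((Formula.assign x t φ).iff (.assign z t (φ.subst x z))) := by
  have hadm := admissible_of_not_occurs x z φ hφ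
  have s1 := Provable.sub2AS x z φ hadm
  have s2 : Provable ((Formula.neg (φ.subst x z)).imp (.assign x (.var z) (.neg φ))) :=
    Provable.sub2AS x z (.neg φ) hadm
  have s3 := consAS x (.var z) φ
  have s4 := Provable.subAS (.var z) t x φ
  have e : Provable ((φ.subst x z).iff (.assign x (.var z) φ)) := by
    refine .mp (mp2' ?_ s1 s2) s3
    intro v hn ha
    simp only [Formula.imp, Formula.iff, hn, ha]; tauto
  have f1 : Provable ((Formula.eq (.var z) t).imp
      ((Formula.assign x t φ).imp (φ.subst x z))) := by
    refine mp2' ?_ e s4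
    intro v hn ha
    simp only [Formula.imp, Formula.iff, hn, ha]; tauto
  have f2 : Provable ((Formula.eq (.var z) t).imp
      ((Formula.neg (.assign x t φ)).imp (.neg (φ.subst x z)))) := by
    refine mp2' ?_ e s4
    intro v hn ha
    simp only [Formula.imp, Formula.iff, hn, ha]; tauto
  have g1 := Provable.mp (.kAS z t _ _) (.mp (monoAS z t f1) (.efAS z t))
  have g2 := Provable.mp (.kAS z t _ _) (.mp (monoAS z t f2) (.efAS z t))
  have hfv : z ∉ (Formula.assign x t φ).fv := by
    simp [Formula.fv, not_mem_fv z φ hφ, Term.not_mem_vars z t ht]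
  have self (χ : Formula) : Provable (χ.imp χ) := by
    refine .taut ?_
    intro v hn ha
    simp only [Formula.imp, hn, ha]; tauto
  have n1 := Provable.necAS z t hfv (self _)
  have n2 := Provable.necAS z t (φ := .neg (.assign x t φ)) hfv (self _)
  have c := consAS z t (φ.subst x z)
  have p1 : Provable ((Formula.assign x t φ).imp (.assign z t (φ.subst x z))) := by
    refine mp2' ?_ n1 g1
    intro v hn ha
    simp only [Formula.imp, hn, ha]; tauto
  refine .mp (.mp (mp2' ?_ n2 g2) c) p1
  intro v hn ha
  simp only [Formula.imp, Formula.iff, hn, ha]; tauto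

end ELAS

open ELAS

/-- relettering of bound variables is derivable in SELAS:
    if z occurs neither in φ nor in t, then ⊢ [x:=t]φ ↔ [z:=t]φ[z/x]. -/
theorem stmt16 (x z : ℕ) (t : Term) (φ : Formula)
    (hφ : ¬ φ.occurs z) (ht : ¬ t.hasVar z) :
    Provable ((Formula.assign x t φ).iff (.assign z t (φ.subst x z))) := by
  exact reletter x z t φ hφ ht
end

section
/- The assignment operator cannot be eliminated: there exist two pointed epistemic models with a common assignment σ, namely models M₁, M₂ each with two worlds s₁, s₂, two agents i, j, a unary predicate P and a name a interpreted as in the construction (η(a,s₁)=j, η(a,s₂)=i, ρ(P,s₁)=∅ in both, ρ(P,s₂)={i,j} in M₁ and ρ(P,s₂)={i} in M₂, with s₁ and s₂ related by R_j, all R_i and R_j reflexive), such that the ELAS formula [x:=a]¬K_a¬P(x) is true at M₁,s₁,σ and false at M₂,s₁,σ, while every formula of the assignment-free fragment EL has the same truth value at M₁,s₁,σ and M₂,s₁,σ. Consequently [x:=a]¬K_a¬P(x) is not equivalent over epistemic models to any EL formula. -/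
open ELAS

/-- Worlds: `false` is s₁, `true` is s₂. Agents: `false` is i, `true` is j.
    Agent j's relation links s₁ and s₂; agent i's relation is the identity.
    The name a is 0, the unary predicate P is 0;
    η(a,s₁) = j, η(a,s₂) = i; ρ(P,s₁) = ∅; ρ(P,s₂) = {i,j}. -/
def M1 : Model where
  W := Bool
  I := Bool
  wNE := inferInstance
  iNE := inferInstance
  R := fun i w v => i = true ∨ w = v
  ρ := fun P w ls => P = 0 ∧ w = true ∧ ∃ u : Bool, ls = [u]
  η := fun a w => if a = 0 then !w else false

/-- Same as M1 except ρ(P,s₂) = {i}. -/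
def M2 : Model where
  W := Bool
  I := Bool
  wNE := inferInstance
  iNE := inferInstance
  R := fun i w v => i = true ∨ w = v
  ρ := fun P w ls => P = 0 ∧ w = true ∧ ls = [false]
  η := fun a w => if a = 0 then !w else false

/-- The distinguishing ELAS formula [x:=a]¬K_a¬P(x), with x = variable 0. -/
def distinguishing : Formula :=
  .assign 0 (.name 0) (.neg (.know (.name 0) (.neg (.pred 0 [.var 0]))))

theorem den_M2_true (t : Term) : (M2.den true (fun _ => false) t : Bool) = false := by
  cases t with
  | var x => rfl
  | name a =>
    change (if a = 0 then !true else false) = false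
    split <;> rfl

theorem den_M1_eq_M2 (w : Bool) (t : Term) :
    (M1.den w (fun _ => false) t : Bool) = M2.den w (fun _ => false) t := by
  cases t <;> rfl

theorem sat_pred_iff (P : ℕ) (ts : List Term) (w : Bool) :
    M1.Sat (.pred P ts) w (fun _ => false) ↔ M2.Sat (.pred P ts) w (fun _ => false) := by
  change (P = 0 ∧ w = true ∧ ∃ u : Bool, ts.map (M1.den w (fun _ => false)) = [u]) ↔
    (P = 0 ∧ w = true ∧ ts.map (M2.den w (fun _ => false)) = [false])
  have h : (M1.den w (fun _ => false) : Term → Bool) = M2.den w (fun _ => false) :=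
    funext (den_M1_eq_M2 w)
  constructor
  · rintro ⟨hP, rfl, u, hu⟩
    refine ⟨hP, rfl, ?_⟩
    match ts, hu with
    | [t], _ => exact congrArg (fun b : Bool => [b]) (den_M2_true t)
  · rintro ⟨hP, rfl, hu⟩
    exact ⟨hP, rfl, false, (congrArg (fun f : Term → Bool => ts.map f) h).trans hu⟩

theorem sat_EL_iff (ψ : Formula) : ψ.inEL → ∀ w : Bool,
    (M1.Sat ψ w (fun _ => false) ↔ M2.Sat ψ w (fun _ => false)) := by
  induction ψ with
  | eq t t' =>
    intro _ w
    change ((M1.den w (fun _ => false) t : Bool) = M1.den w (fun _ => false) t') ↔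
      ((M2.den w (fun _ => false) t : Bool) = M2.den w (fun _ => false) t')
    have h1 := den_M1_eq_M2 w t
    have h2 := den_M1_eq_M2 w t'
    exact ⟨fun h => h1.symm.trans (h.trans h2), fun h => h1.trans (h.trans h2.symm)⟩
  | pred P ts => exact fun _ w => sat_pred_iff P ts w
  | neg φ ih => exact fun h w => not_congr (ih h w)
  | and φ χ ih1 ih2 => exact fun h w => and_congr (ih1 h.1 w) (ih2 h.2 w)
  | know t φ ih =>
    intro h w
    have h1 := den_M1_eq_M2 w t
    constructor
    · intro hs v hv
      exact (ih h v).1 (hs v (hv.imp (fun e => h1.trans e) id))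
    · intro hs v hv
      exact (ih h v).2 (hs v (hv.imp (fun e => h1.symm.trans e) id))
  | assign x t φ ih => exact fun h => h.elim

theorem equiv_rel (i : Bool) : Equivalence (fun w v : Bool => i = true ∨ w = v) := by
  refine ⟨fun _ => Or.inr rfl, ?_, ?_⟩
  · rintro x y (h | h)
    · exact Or.inl h
    · exact Or.inr h.symm
  · rintro x y z (h | h) (h' | h')
    · exact Or.inl h
    · exact Or.inl h
    · exact Or.inl h'
    · exact Or.inr (h.trans h')

theorem sat_dist_M1 : M1.Sat distinguishing false (fun _ => false) := by
  intro h
  exact h true (Or.inl rfl) ⟨rfl, rfl, _, rfl⟩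

theorem not_sat_dist_M2 : ¬ M2.Sat distinguishing false (fun _ => false) := by
  intro h
  apply h
  rintro v - ⟨-, -, hv⟩
  have hv' : [true] = [false] := hv
  simp at hv'

/-- the assignment operator cannot be eliminated: in the two
    pointed epistemic models (M1,s₁) and (M2,s₁) with the constant assignment
    σ(x) = i, the formula [x:=a]¬K_a¬P(x) is true in the first and false in the
    second, while every assignment-free (EL) formula has the same truth value at
    both; consequently [x:=a]¬K_a¬P(x) is not equivalent over epistemic models
    to any EL formula. -/
theorem stmt17 :
    M1.Epistemic ∧ M2.Epistemic ∧
    M1.Sat distinguishing false (fun _ => false) ∧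
    ¬ M2.Sat distinguishing false (fun _ => false) ∧
    (∀ ψ : Formula, ψ.inEL →
      (M1.Sat ψ false (fun _ => false) ↔ M2.Sat ψ false (fun _ => false))) ∧
    ¬ ∃ ψ : Formula, ψ.inEL ∧
      ∀ (M : Model), M.Epistemic → ∀ (w : M.W) (σ : ℕ → M.I),
        (M.Sat distinguishing w σ ↔ M.Sat ψ w σ) := by
  refine ⟨equiv_rel, equiv_rel, sat_dist_M1, not_sat_dist_M2,
    fun ψ h => sat_EL_iff ψ h false, ?_⟩
  rintro ⟨ψ, hψ, h⟩
  exact not_sat_dist_M2 ((h M2 equiv_rel false _).2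
    ((sat_EL_iff ψ hψ false).1 ((h M1 equiv_rel false _).1 sat_dist_M1)))
end

section
/- Strong completeness of SELAS over epistemic models: every SELAS-consistent set Γ of ELAS formulas is satisfiable in an epistemic model with an assignment; that is, there exist an epistemic model M, a world w of M, and a variable assignment σ such that M,w,σ ⊨ φ for every φ ∈ Γ. In particular, every ELAS formula valid over epistemic models is derivable in SELAS. -/
open ELAS

/-- Γ is SELAS-consistent: no finite conjunction of members of Γ has its negation
    derivable in SELAS. -/
def ConsistentSet (Γ : Set Formula) : Prop :=
  ¬ ∃ l : List Formula, (∀ ψ ∈ l, ψ ∈ Γ) ∧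
    Provable (Formula.neg (Formula.conjList l))

namespace ELAS

/-! ### Renaming of variables -/

def Term.rename (f : ℕ → ℕ) : Term → Term
  | .var x => .var (f x)
  | .name a => .name a

def Formula.rename (f : ℕ → ℕ) : Formula → Formula
  | .eq t t' => .eq (t.rename f) (t'.rename f)
  | .pred P ts => .pred P (ts.map (Term.rename f))
  | .neg φ => .neg (φ.rename f)
  | .and φ ψ => .and (φ.rename f) (ψ.rename f)
  | .know t φ => .know (t.rename f) (φ.rename f)
  | .assign x t φ => .assign (f x) (t.rename f) (φ.rename f)

theorem mem_fv_pred (x P : ℕ) (ts : List Term) :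
    x ∈ (Formula.pred P ts).fv ↔ ∃ t ∈ ts, x ∈ t.vars := by
  simp only [Formula.fv]
  induction ts with
  | nil => simp
  | cons t ts ih => simp [ih]

theorem Term.mem_vars_rename {f : ℕ → ℕ} (hf : f.Injective) (t : Term) (x : ℕ) :
    f x ∈ (t.rename f).vars ↔ x ∈ t.vars := by
  cases t <;> simp [Term.rename, Term.vars, hf.eq_iff]

theorem Formula.mem_fv_rename {f : ℕ → ℕ} (hf : f.Injective) (φ : Formula) (x : ℕ) :
    f x ∈ (φ.rename f).fv ↔ x ∈ φ.fv := by
  induction φ with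
  | eq t t' => simp [Formula.rename, Formula.fv, Term.mem_vars_rename hf]
  | pred P ts =>
    rw [mem_fv_pred, Formula.rename, mem_fv_pred]
    simp [Term.mem_vars_rename hf]
  | neg φ ih => simpa [Formula.rename, Formula.fv] using ih
  | and φ ψ ih1 ih2 => simp [Formula.rename, Formula.fv, ih1, ih2]
  | know t φ ih => simp [Formula.rename, Formula.fv, ih, Term.mem_vars_rename hf]
  | assign z t φ ih =>
    simp [Formula.rename, Formula.fv, ih, Term.mem_vars_rename hf, hf.eq_iff]

theorem Term.subst_rename {f : ℕ → ℕ} (hf : f.Injective) (t : Term) (x y : ℕ) :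
    (t.subst x y).rename f = (t.rename f).subst (f x) (f y) := by
  cases t with
  | var z =>
    by_cases h : z = x
    · simp [Term.subst, Term.rename, h]
    · simp [Term.subst, Term.rename, h, hf.eq_iff]
  | name a => rfl

theorem Formula.subst_rename {f : ℕ → ℕ} (hf : f.Injective) (φ : Formula) (x y : ℕ) :
    (φ.subst x y).rename f = (φ.rename f).subst (f x) (f y) := by
  induction φ with
  | eq t t' => simp [Formula.rename, Formula.subst, Term.subst_rename hf]
  | pred P ts => simp [Formula.rename, Formula.subst, Term.subst_rename hf]
  | neg φ ih => simp [Formula.rename, Formula.subst, ih]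
  | and φ ψ ih1 ih2 => simp [Formula.rename, Formula.subst, ih1, ih2]
  | know t φ ih => simp [Formula.rename, Formula.subst, ih, Term.subst_rename hf]
  | assign z t φ ih =>
    simp only [Formula.rename, Formula.subst, hf.eq_iff]
    split <;> simp [Formula.rename, ih, Term.subst_rename hf]

theorem Formula.admissible_rename {f : ℕ → ℕ} (hf : f.Injective) (φ : Formula) (x y : ℕ)
    (h : φ.admissible x y) : (φ.rename f).admissible (f x) (f y) := by
  induction φ with
  | eq t t' => trivial
  | pred P ts => trivial
  | neg φ ih => exact ih h
  | and φ ψ ih1 ih2 => exact ⟨ih1 h.1, ih2 h.2⟩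
  | know t φ ih => exact ih h
  | assign z t φ ih =>
    simp only [Formula.rename, Formula.admissible, hf.eq_iff, Formula.mem_fv_rename hf, ne_eq]
      at h ⊢
    rcases h with h | h
    · exact Or.inl h
    · exact Or.inr ⟨h.1, ih h.2⟩

theorem Formula.conjList_rename (f : ℕ → ℕ) (l : List Formula) :
    (Formula.conjList l).rename f = Formula.conjList (l.map (Formula.rename f)) := by
  induction l with
  | nil => rfl
  | cons a l ih => simp [Formula.conjList, Formula.rename, ih]

theorem zipWith_rename (f : ℕ → ℕ) (ts ts' : List Term) :
    (List.zipWith Formula.eq ts ts').map (Formula.rename f) =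
      List.zipWith Formula.eq (ts.map (Term.rename f)) (ts'.map (Term.rename f)) := by
  induction ts generalizing ts' with
  | nil => simp
  | cons a l ih =>
    cases ts' with
    | nil => simp
    | cons b l' => simp [ih, Formula.rename]

theorem Provable.rename {f : ℕ → ℕ} (hf : f.Injective) {φ : Formula} (h : Provable φ) :
    Provable (φ.rename f) := by
  induction h with
  | taut h =>
    refine .taut fun v hn ha => ?_
    exact h (fun ψ => v (ψ.rename f)) (fun ψ => hn _) (fun ψ χ => ha _ _)
  | distK t φ ψ => exact .distK _ _ _
  | tx x φ => exact .tx _ _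
  | four_x x φ => exact .four_x _ _
  | five_x x φ => exact .five_x _ _
  | id t => exact .id _
  | subP P ts ts' h =>
    have := Provable.subP P (ts.map (Term.rename f)) (ts'.map (Term.rename f)) (by simpa using h)
    rw [← zipWith_rename, ← Formula.conjList_rename] at this
    exact this
  | subEq a b c d => exact .subEq _ _ _ _
  | subK t t' φ => exact .subK _ _ _
  | subAS t t' x φ => exact .subAS _ _ _ _
  | rigidP x y t => exact .rigidP _ _ _
  | rigidN x y t => exact .rigidN _ _ _
  | kAS x t φ ψ => exact .kAS _ _ _ _
  | detAS x t φ => exact .detAS _ _ _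
  | dAS x t => exact .dAS _ _
  | efAS x t => exact .efAS _ _
  | sub2AS x y φ h =>
    have := Provable.sub2AS (f x) (f y) (φ.rename f) (Formula.admissible_rename hf _ _ _ h)
    rw [← Formula.subst_rename hf] at this
    exact this
  | mp _ _ ih1 ih2 => exact .mp ih1 ih2
  | necK t _ ih => exact .necK _ ih
  | necAS x t h _ ih => exact .necAS _ _ (by rwa [Formula.mem_fv_rename hf]) ih

theorem Term.rename_cancel (f : ℕ → ℕ) (t : Term) :
    ∃ B, ∀ g : ℕ → ℕ, (∀ x < B, g (f x) = x) → (t.rename f).rename g = t := by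
  cases t with
  | var x => exact ⟨x + 1, fun g h => by simp [Term.rename, h x (by omega)]⟩
  | name a => exact ⟨0, fun g h => rfl⟩

theorem Formula.rename_cancel (f : ℕ → ℕ) (φ : Formula) :
    ∃ B, ∀ g : ℕ → ℕ, (∀ x < B, g (f x) = x) → (φ.rename f).rename g = φ := by
  induction φ with
  | eq t t' =>
    obtain ⟨B, hB⟩ := Term.rename_cancel f t
    obtain ⟨B', hB'⟩ := Term.rename_cancel f t'
    refine ⟨max B B', fun g h => ?_⟩
    simp only [Formula.rename]
    rw [hB g fun x hx => h x (by omega), hB' g fun x hx => h x (by omega)]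
  | pred P ts =>
    have : ∃ B, ∀ g : ℕ → ℕ, (∀ x < B, g (f x) = x) →
        (ts.map (Term.rename f)).map (Term.rename g) = ts := by
      induction ts with
      | nil => exact ⟨0, fun _ _ => rfl⟩
      | cons t ts ih =>
        obtain ⟨B, hB⟩ := Term.rename_cancel f t
        obtain ⟨B', hB'⟩ := ih
        refine ⟨max B B', fun g h => ?_⟩
        rw [List.map_cons, List.map_cons, hB g fun x hx => h x (by omega),
          hB' g fun x hx => h x (by omega)]
    obtain ⟨B, hB⟩ := this
    exact ⟨B, fun g h => by simp only [Formula.rename]; rw [hB g h]⟩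
  | neg φ ih =>
    obtain ⟨B, hB⟩ := ih
    exact ⟨B, fun g h => by simp only [Formula.rename]; rw [hB g h]⟩
  | and φ ψ ih1 ih2 =>
    obtain ⟨B, hB⟩ := ih1
    obtain ⟨B', hB'⟩ := ih2
    refine ⟨max B B', fun g h => ?_⟩
    simp only [Formula.rename]
    rw [hB g fun x hx => h x (by omega), hB' g fun x hx => h x (by omega)]
  | know t φ ih =>
    obtain ⟨B, hB⟩ := ih
    obtain ⟨B', hB'⟩ := Term.rename_cancel f t
    refine ⟨max B B', fun g h => ?_⟩
    simp only [Formula.rename]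
    rw [hB g fun x hx => h x (by omega), hB' g fun x hx => h x (by omega)]
  | assign z t φ ih =>
    obtain ⟨B, hB⟩ := ih
    obtain ⟨B', hB'⟩ := Term.rename_cancel f t
    refine ⟨max (z + 1) (max B B'), fun g h => ?_⟩
    simp only [Formula.rename]
    rw [hB g fun x hx => h x (by omega), hB' g fun x hx => h x (by omega), h z (by omega)]

theorem Provable.of_rename {φ : Formula} (h : Provable (φ.rename (fun x => 2 * x))) :
    Provable φ := by
  obtain ⟨B, hB⟩ := Formula.rename_cancel (fun x => 2 * x) φ
  have hg : Function.Injective (fun n : ℕ => if n % 2 = 0 ∧ n / 2 < B then n / 2 else n + B) := by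
    intro a b hab
    simp only at hab
    split_ifs at hab <;> omega
  have := h.rename hg
  rwa [hB] at this
  intro x hx
  have h1 : 2 * x % 2 = 0 := by omega
  have h2 : 2 * x / 2 = x := by omega
  simp [h2, hx]

theorem consistent_rename {Γ : Set Formula} (h : ConsistentSet Γ) :
    ConsistentSet (Formula.rename (fun x => 2 * x) '' Γ) := by
  rintro ⟨l, hl, hp⟩
  apply h
  have : ∃ l' : List Formula, (∀ ψ ∈ l', ψ ∈ Γ) ∧ l'.map (Formula.rename (fun x => 2 * x)) = l := by
    clear hp
    induction l with
    | nil => exact ⟨[], by simp, rfl⟩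
    | cons a l ih =>
      obtain ⟨l', h1, h2⟩ := ih fun ψ hψ => hl ψ (by simp [hψ])
      obtain ⟨b, hb, rfl⟩ := hl a (by simp)
      refine ⟨b :: l', ?_, by simp [h2]⟩
      intro ψ hψ
      rcases List.mem_cons.1 hψ with rfl | hψ
      · exact hb
      · exact h1 _ hψ
  obtain ⟨l', h1, rfl⟩ := this
  refine ⟨l', h1, Provable.of_rename ?_⟩
  rw [← Formula.conjList_rename] at hp
  exact hp

theorem den_rename (M : Model) (f : ℕ → ℕ) (w : M.W) (σ : ℕ → M.I) (t : Term) :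
    M.den w σ (t.rename f) = M.den w (σ ∘ f) t := by
  cases t <;> rfl

theorem sat_rename (M : Model) {f : ℕ → ℕ} (hf : f.Injective) (φ : Formula) (w : M.W)
    (σ : ℕ → M.I) : M.Sat (φ.rename f) w σ ↔ M.Sat φ w (σ ∘ f) := by
  induction φ generalizing w σ with
  | eq t t' => simp [Formula.rename, Model.Sat, den_rename]
  | pred P ts =>
    simp only [Formula.rename, Model.Sat, List.map_map]
    have : (M.den w σ ∘ Term.rename f) = M.den w (σ ∘ f) := funext fun t => den_rename M f w σ t
    rw [this]
  | neg φ ih => simp [Formula.rename, Model.Sat, ih]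
  | and φ ψ ih1 ih2 => simp [Formula.rename, Model.Sat, ih1, ih2]
  | know t φ ih => simp [Formula.rename, Model.Sat, ih, den_rename]
  | assign z t φ ih =>
    simp only [Formula.rename, Model.Sat, ih, den_rename]
    rw [Function.update_comp_eq_of_injective _ hf]

/-! ### Countability -/

def Term.code : Term → ℕ
  | .var x => 2 * x
  | .name x => 2 * x + 1

theorem Term.code_inj : Function.Injective Term.code := by
  intro a b h
  cases a <;> cases b <;> simp [Term.code] at h ⊢ <;> omega

def Formula.code : Formula → ℕ
  | .eq t t' => Nat.pair 0 (Nat.pair t.code t'.code)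
  | .pred P ts => Nat.pair 1 (Nat.pair P (Encodable.encode (ts.map Term.code)))
  | .neg φ => Nat.pair 2 φ.code
  | .and φ ψ => Nat.pair 3 (Nat.pair φ.code ψ.code)
  | .know t φ => Nat.pair 4 (Nat.pair t.code φ.code)
  | .assign x t φ => Nat.pair 5 (Nat.pair x (Nat.pair t.code φ.code))

theorem Formula.code_inj : Function.Injective Formula.code := by
  intro a
  induction a with
  | eq t t' =>
    intro b h
    cases b <;> simp [Formula.code, Term.code_inj.eq_iff] at h ⊢; exact h
  | pred P ts =>
    intro b h
    cases b <;> simp [Formula.code] at h ⊢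
    exact ⟨h.1, (List.map_injective_iff.2 Term.code_inj) h.2⟩
  | neg φ ih =>
    intro b h
    cases b <;> simp [Formula.code] at h ⊢
    exact ih h
  | and φ ψ ih1 ih2 =>
    intro b h
    cases b <;> simp [Formula.code] at h ⊢
    exact ⟨ih1 h.1, ih2 h.2⟩
  | know t φ ih =>
    intro b h
    cases b <;> simp [Formula.code] at h ⊢
    exact ⟨Term.code_inj h.1, ih h.2⟩
  | assign x t φ ih =>
    intro b h
    cases b <;> simp [Formula.code] at h ⊢
    exact ⟨h.1, Term.code_inj h.2.1, ih h.2.2⟩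

instance : Countable Formula := Formula.code_inj.countable
instance : Countable Term := Term.code_inj.countable
instance : Nonempty Formula := ⟨Formula.top⟩
instance : Nonempty Term := ⟨Term.var 0⟩

theorem exists_tasks : ∃ e : ℕ → ℕ × Term × ℕ × Formula,
    ∀ τ N, ∃ k, N ≤ k ∧ e k = τ := by
  obtain ⟨g, hg⟩ := exists_surjective_nat (ℕ × Term × ℕ × Formula)
  refine ⟨fun k => g (Nat.unpair k).2, fun τ N => ?_⟩
  obtain ⟨m, hm⟩ := hg τ
  exact ⟨Nat.pair N m, Nat.left_le_pair _ _, by simpa using hm⟩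

/-! ### Maximal consistent sets -/

structure MCS (Δ : Set Formula) : Prop where
  thm : ∀ {φ}, Provable φ → φ ∈ Δ
  mp : ∀ {φ ψ : Formula}, φ.imp ψ ∈ Δ → φ ∈ Δ → ψ ∈ Δ
  neg : ∀ φ : Formula, φ.neg ∈ Δ ↔ φ ∉ Δ

theorem v_imp {v : Formula → Prop} (hn : ∀ ψ, v (.neg ψ) ↔ ¬ v ψ)
    (ha : ∀ ψ χ, v (.and ψ χ) ↔ (v ψ ∧ v χ)) (φ ψ : Formula) : v (φ.imp ψ) ↔ (v φ → v ψ) := by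
  simp [Formula.imp, hn, ha]

theorem v_iff {v : Formula → Prop} (hn : ∀ ψ, v (.neg ψ) ↔ ¬ v ψ)
    (ha : ∀ ψ χ, v (.and ψ χ) ↔ (v ψ ∧ v χ)) (φ ψ : Formula) : v (φ.iff ψ) ↔ (v φ ↔ v ψ) := by
  rw [Formula.iff, ha, v_imp hn ha, v_imp hn ha]; tauto

theorem v_conj {v : Formula → Prop} (hn : ∀ ψ, v (.neg ψ) ↔ ¬ v ψ)
    (ha : ∀ ψ χ, v (.and ψ χ) ↔ (v ψ ∧ v χ)) (l : List Formula) :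
    v (Formula.conjList l) ↔ ∀ ψ ∈ l, v ψ := by
  induction l with
  | nil => simp [Formula.conjList, Formula.top, v_imp hn ha]
  | cons a l ih => simp [Formula.conjList, ha, ih]

theorem Provable.taut1 {φ ψ : Formula} (h : Provable φ)
    (ht : ∀ v : Formula → Prop, (∀ ψ, v (.neg ψ) ↔ ¬ v ψ) →
      (∀ ψ χ, v (.and ψ χ) ↔ (v ψ ∧ v χ)) → v φ → v ψ) : Provable ψ :=
  .mp (.taut fun v hn ha => (v_imp hn ha _ _).2 (ht v hn ha)) h

theorem Provable.taut2 {φ ψ χ : Formula} (h : Provable φ) (h' : Provable ψ)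
    (ht : ∀ v : Formula → Prop, (∀ ψ, v (.neg ψ) ↔ ¬ v ψ) →
      (∀ ψ χ, v (.and ψ χ) ↔ (v ψ ∧ v χ)) → v φ → v ψ → v χ) : Provable χ :=
  .mp (.taut1 h (ψ := ψ.imp χ) fun v hn ha h => (v_imp hn ha _ _).2 (ht v hn ha h)) h'

namespace MCS
variable {Δ : Set Formula}

theorem and (h : MCS Δ) (φ ψ : Formula) : φ.and ψ ∈ Δ ↔ φ ∈ Δ ∧ ψ ∈ Δ := by
  constructor
  · intro hm
    exact ⟨h.mp (h.thm (.taut fun v hn ha => by rw [v_imp hn ha, ha]; tauto)) hm,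
      h.mp (h.thm (.taut fun v hn ha => by rw [v_imp hn ha, ha]; tauto)) hm⟩
  · rintro ⟨h1, h2⟩
    exact h.mp (h.mp (h.thm (.taut fun v hn ha => by
      rw [v_imp hn ha, v_imp hn ha, ha]; tauto)) h1) h2

theorem imp (h : MCS Δ) (φ ψ : Formula) : φ.imp ψ ∈ Δ ↔ (φ ∈ Δ → ψ ∈ Δ) :=
  v_imp (v := fun φ => φ ∈ Δ) h.neg h.and φ ψ

theorem iff (h : MCS Δ) (φ ψ : Formula) : φ.iff ψ ∈ Δ ↔ (φ ∈ Δ ↔ ψ ∈ Δ) :=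
  v_iff (v := fun φ => φ ∈ Δ) h.neg h.and φ ψ

theorem conj (h : MCS Δ) (l : List Formula) : Formula.conjList l ∈ Δ ↔ ∀ ψ ∈ l, ψ ∈ Δ :=
  v_conj (v := fun φ => φ ∈ Δ) h.neg h.and l

theorem use (h : MCS Δ) {φ ψ : Formula} (hp : Provable (φ.imp ψ)) (hφ : φ ∈ Δ) : ψ ∈ Δ :=
  h.mp (h.thm hp) hφ

theorem refl (h : MCS Δ) (t : Term) : Formula.eq t t ∈ Δ := h.thm (.id t)

theorem eq_congr (h : MCS Δ) {a b c d : Term} (h1 : Formula.eq a c ∈ Δ)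
    (h2 : Formula.eq b d ∈ Δ) : Formula.eq a b ∈ Δ ↔ Formula.eq c d ∈ Δ :=
  (h.iff _ _).1 (h.use (.subEq a b c d) ((h.and _ _).2 ⟨h1, h2⟩))

theorem symm (h : MCS Δ) {a b : Term} (h1 : Formula.eq a b ∈ Δ) : Formula.eq b a ∈ Δ :=
  (h.eq_congr h1 (h.refl a)).1 (h.refl a)

theorem trans (h : MCS Δ) {a b c : Term} (h1 : Formula.eq a b ∈ Δ) (h2 : Formula.eq b c ∈ Δ) :
    Formula.eq a c ∈ Δ :=
  (h.eq_congr (h.refl a) h2).1 h1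

theorem know_congr (h : MCS Δ) {a b : Term} (h1 : Formula.eq a b ∈ Δ) (φ : Formula) :
    Formula.know a φ ∈ Δ ↔ Formula.know b φ ∈ Δ :=
  (h.iff _ _).1 (h.use (.subK a b φ) h1)

theorem assign_congr (h : MCS Δ) {a b : Term} (h1 : Formula.eq a b ∈ Δ) (x : ℕ) (φ : Formula) :
    Formula.assign x a φ ∈ Δ ↔ Formula.assign x b φ ∈ Δ :=
  (h.iff _ _).1 (h.use (.subAS a b x φ) h1)

end MCS

theorem lindenbaum {Γ : Set Formula} (h : ConsistentSet Γ) : ∃ Δ, Γ ⊆ Δ ∧ MCS Δ := by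
  obtain ⟨Δ, hΓ, hmax⟩ := zorn_subset_nonempty {S : Set Formula | ConsistentSet S} (by
    intro c hc hchain hne
    refine ⟨⋃₀ c, ?_, fun s hs => Set.subset_sUnion_of_mem hs⟩
    rintro ⟨l, hl, hp⟩
    have : ∃ S ∈ c, ∀ ψ ∈ l, ψ ∈ S := by
      clear hp
      induction l with
      | nil => obtain ⟨S, hS⟩ := hne; exact ⟨S, hS, by simp⟩
      | cons a l ih =>
        obtain ⟨S, hS, hSl⟩ := ih fun ψ hψ => hl ψ (by simp [hψ])
        obtain ⟨T, hT, haT⟩ := hl a (by simp)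
        rcases hchain.total hS hT with hst | hst
        · exact ⟨T, hT, by simp only [List.mem_cons, forall_eq_or_imp]; exact ⟨haT, fun ψ hψ => hst (hSl ψ hψ)⟩⟩
        · exact ⟨S, hS, by simp only [List.mem_cons, forall_eq_or_imp]; exact ⟨hst haT, fun ψ hψ => hSl ψ hψ⟩⟩
    obtain ⟨S, hS, hSl⟩ := this
    exact hc hS ⟨l, hSl, hp⟩) Γ h
  have hcon : ConsistentSet Δ := hmax.prop
  -- adding a formula outside of `Δ` makes it inconsistent
  have key : ∀ φ, φ ∉ Δ → ∃ l : List Formula, (∀ ψ ∈ l, ψ ∈ Δ) ∧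
      Provable ((Formula.conjList l).imp φ.neg) := by
    intro φ hφ
    have hnc : ¬ ConsistentSet (insert φ Δ) := fun hc =>
      hφ (hmax.le_of_ge hc (Set.subset_insert _ _) (Set.mem_insert _ _))
    rw [ConsistentSet, not_not] at hnc
    obtain ⟨l, hl, hp⟩ := hnc
    classical
    refine ⟨l.filter (fun ψ => ψ ∈ Δ), fun ψ hψ => by simpa using (List.mem_filter.1 hψ).2, ?_⟩
    refine .taut1 hp fun v hn ha hv => ?_
    rw [hn, v_conj hn ha] at hv
    rw [v_imp hn ha, v_conj hn ha, hn]
    intro h1 h2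
    apply hv
    intro ψ hψ
    rcases hl ψ hψ with rfl | hm
    · exact h2
    · exact h1 ψ (List.mem_filter.2 ⟨hψ, by simpa using hm⟩)
  have closed : ∀ (l : List Formula) φ, (∀ ψ ∈ l, ψ ∈ Δ) → Provable ((Formula.conjList l).imp φ) →
      φ ∈ Δ := by
    intro l φ hl hp
    by_contra hφ
    obtain ⟨l', hl', hp'⟩ := key φ hφ
    refine hcon ⟨l ++ l', ?_, .taut2 hp hp' fun v hn ha h1 h2 => ?_⟩
    · intro ψ hψ
      rcases List.mem_append.1 hψ with h | h
      · exact hl _ h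
      · exact hl' _ h
    · rw [v_imp hn ha, v_conj hn ha] at h1 h2
      rw [hn] at h2
      rw [hn, v_conj hn ha]
      intro h3
      exact h2 (fun ψ hψ => h3 ψ (by simp [hψ])) (h1 fun ψ hψ => h3 ψ (by simp [hψ]))
  refine ⟨Δ, hΓ, ⟨fun {φ} hp => ?_, fun {φ ψ} h1 h2 => ?_, fun φ => ⟨fun h1 h2 => ?_, fun h1 => ?_⟩⟩⟩
  · exact closed [] φ (by simp) (.taut1 hp fun v hn ha hv => by rw [v_imp hn ha]; tauto)
  · refine closed [φ.imp ψ, φ] ψ (by simp [h1, h2]) (.taut fun v hn ha => ?_)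
    rw [v_imp hn ha, v_conj hn ha]
    simp only [List.mem_cons, List.not_mem_nil, or_false, forall_eq_or_imp, forall_eq, v_imp hn ha]
    tauto
  · refine hcon ⟨[φ.neg, φ], by simp [h1, h2], .taut fun v hn ha => ?_⟩
    rw [hn, v_conj hn ha]
    simp only [List.mem_cons, List.not_mem_nil, or_false, forall_eq_or_imp, forall_eq, hn]
    tauto
  · obtain ⟨l, hl, hp⟩ := key φ h1
    exact closed l _ hl hp

/-- Extension of a union of two sets, one of which is closed under conjunction. -/
theorem lindenbaum_union {A B : Set Formula}
    (h : ∀ l l' : List Formula, (∀ ψ ∈ l, ψ ∈ A) → (∀ ψ ∈ l', ψ ∈ B) →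
      ¬ Provable ((Formula.conjList l).imp (Formula.conjList l').neg)) :
    ∃ Δ, A ⊆ Δ ∧ B ⊆ Δ ∧ MCS Δ := by
  have : ConsistentSet (A ∪ B) := by
    rintro ⟨l, hl, hp⟩
    classical
    refine h (l.filter (fun ψ => ψ ∈ A)) (l.filter (fun ψ => ψ ∈ B))
      (fun ψ hψ => by simpa using (List.mem_filter.1 hψ).2)
      (fun ψ hψ => by simpa using (List.mem_filter.1 hψ).2) ?_
    refine .taut1 hp fun v hn ha hv => ?_
    rw [hn, v_conj hn ha] at hv
    rw [v_imp hn ha, hn, v_conj hn ha, v_conj hn ha]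
    intro h1 h2
    apply hv
    intro ψ hψ
    rcases hl ψ hψ with hm | hm
    · exact h1 ψ (List.mem_filter.2 ⟨hψ, by simpa using hm⟩)
    · exact h2 ψ (List.mem_filter.2 ⟨hψ, by simpa using hm⟩)
  obtain ⟨Δ, h1, h2⟩ := lindenbaum this
  exact ⟨Δ, fun x hx => h1 (Or.inl hx), fun x hx => h1 (Or.inr hx), h2⟩

theorem Provable.know_mono {φ ψ : Formula} (t : Term) (h : Provable (φ.imp ψ)) :
    Provable ((Formula.know t φ).imp (.know t ψ)) :=
  .mp (.distK t φ ψ) (.necK t h)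

theorem MCS.know_conj {Δ : Set Formula} (h : MCS Δ) (t : Term) (l : List Formula)
    (hl : ∀ ψ ∈ l, Formula.know t ψ ∈ Δ) : Formula.know t (Formula.conjList l) ∈ Δ := by
  induction l with
  | nil =>
    refine h.thm (.necK t (.taut fun v hn ha => ?_))
    rw [v_conj hn ha]; simp
  | cons a l ih =>
    have h1 := hl a (by simp)
    have h2 := ih fun ψ hψ => hl ψ (by simp [hψ])
    have h3 : Provable (a.imp ((Formula.conjList l).imp (Formula.conjList (a :: l)))) :=
      .taut fun v hn ha => by
        rw [v_imp hn ha, v_imp hn ha, Formula.conjList, ha]; tauto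
    exact h.mp (h.use (.distK _ _ _) (h.use (h3.know_mono t) h1)) h2

def Agree (x : ℕ) (Δ Δ' : Set Formula) : Prop :=
  ∀ ψ, Formula.know (.var x) ψ ∈ Δ ↔ Formula.know (.var x) ψ ∈ Δ'

def Lang (V : Set ℕ) (φ : Formula) : Prop := ∀ x ∈ φ.fv, x ∈ V

def EqOn (V : Set ℕ) (Δ Δ' : Set Formula) : Prop := ∀ φ, Lang V φ → (φ ∈ Δ ↔ φ ∈ Δ')

theorem agree_of {x : ℕ} {Δ Δ' : Set Formula} (h : MCS Δ) (h' : MCS Δ')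
    (hs : {ψ | Formula.know (.var x) ψ ∈ Δ} ⊆ Δ') : Agree x Δ Δ' := by
  intro ψ
  constructor
  · intro h1
    exact hs (h.use (.four_x x ψ) h1)
  · intro h1
    by_contra h2
    have := hs (h.use (.five_x x ψ) ((h.neg _).2 h2))
    exact (h'.neg _).1 this h1

theorem eqOn_of {V : Set ℕ} {Δ Δ' : Set Formula} (h : MCS Δ) (h' : MCS Δ')
    (hs : {ψ | ψ ∈ Δ' ∧ Lang V ψ} ⊆ Δ) : EqOn V Δ Δ' := by
  intro ψ hψ
  constructor
  · intro h1
    by_contra h2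
    exact (h.neg _).1 (hs ⟨(h'.neg _).2 h2, hψ⟩) h1
  · intro h1
    exact hs ⟨h1, hψ⟩

theorem lang_conj {V : Set ℕ} {l : List Formula} (h : ∀ ψ ∈ l, Lang V ψ) :
    Lang V (Formula.conjList l) := by
  induction l with
  | nil => intro x hx; simp [Formula.conjList, Formula.top, Formula.imp, Formula.fv, Term.vars] at hx
  | cons a l ih =>
    intro x hx
    rcases Finset.mem_union.1 hx with h1 | h1
    · exact h a (by simp) x h1
    · exact ih (fun ψ hψ => h ψ (by simp [hψ])) x h1

theorem exists_know_ext {Θ B : Set Formula} {x : ℕ} (h : MCS Θ)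
    (hB : ∀ l : List Formula, (∀ ψ ∈ l, ψ ∈ B) →
      Formula.know (.var x) (Formula.conjList l).neg ∉ Θ) :
    ∃ Θ', MCS Θ' ∧ Agree x Θ Θ' ∧ B ⊆ Θ' := by
  obtain ⟨Θ', h1, h2, h3⟩ := lindenbaum_union (A := {ψ | Formula.know (.var x) ψ ∈ Θ}) (B := B) (by
    intro l l' hl hl' hp
    exact hB l' hl' (h.use (hp.know_mono _) (h.know_conj _ l hl)))
  exact ⟨Θ', h3, agree_of h h3 h1, h2⟩

theorem neighbour {V : Set ℕ} {x : ℕ} (hx : x ∈ V) {Δ Δ' Θ : Set Formula} (hΔ : MCS Δ)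
    (hΔ' : MCS Δ') (hΘ : MCS Θ) (ha : Agree x Δ Δ') (he : EqOn V Θ Δ) :
    ∃ Θ', MCS Θ' ∧ Agree x Θ Θ' ∧ EqOn V Θ' Δ' := by
  obtain ⟨Θ', h1, h2, h3⟩ := exists_know_ext (B := {ψ | ψ ∈ Δ' ∧ Lang V ψ}) (x := x) hΘ (by
    intro l hl hk
    have hlang : Lang V (Formula.conjList l) := lang_conj fun ψ hψ => (hl ψ hψ).2
    have h1 := (he _ (by
      intro z hz
      simp only [Formula.fv, Term.vars, Finset.mem_union, Finset.mem_singleton] at hz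
      rcases hz with rfl | hz
      · exact hx
      · exact hlang z hz)).1 hk
    have h2 := hΔ'.use (.tx _ _) ((ha _).1 h1)
    exact (hΔ'.neg _).1 h2 ((hΔ'.conj _).2 fun ψ hψ => (hl ψ hψ).1))
  exact ⟨Θ', h1, h2, eqOn_of h1 hΔ' h3⟩

theorem child {x : ℕ} {Θ : Set Formula} {φ : Formula} (h : MCS Θ) :
    ∃ Θ', MCS Θ' ∧ Agree x Θ Θ' ∧ ((Formula.know (.var x) φ).neg ∈ Θ → φ.neg ∈ Θ') := by
  by_cases hk : (Formula.know (.var x) φ).neg ∈ Θ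
  · obtain ⟨Θ', h1, h2, h3⟩ := exists_know_ext (B := {φ.neg}) (x := x) h (by
      intro l hl hk'
      refine (h.neg _).1 hk (h.use (Provable.know_mono _ (.taut fun v hn ha => ?_)) hk')
      rw [v_imp hn ha, hn, v_conj hn ha]
      intro h1
      by_contra h2
      apply h1
      intro ψ hψ
      rw [hl ψ hψ, hn]
      exact h2)
    exact ⟨Θ', h1, h2, fun _ => h3 rfl⟩
  · exact ⟨Θ, h, fun _ => Iff.rfl, fun h' => absurd h' hk⟩

theorem assign_mono {φ ψ : Formula} (x : ℕ) (t : Term) (h : Provable (φ.imp ψ)) :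
    Provable ((Formula.assign x t φ).imp (.assign x t ψ)) := by
  refine .mp (.kAS x t φ ψ) ?_
  have h1 : Provable (Formula.top.imp (φ.imp ψ)) := .taut1 h fun v hn ha hv => by
    rw [v_imp hn ha]; exact fun _ => hv
  have h2 := Provable.necAS x t (by simp [Formula.top, Formula.imp, Formula.fv, Term.vars]) h1
  exact .mp h2 (.taut fun v hn ha => by rw [Formula.top, v_imp hn ha]; exact fun h => h)

theorem MCS.not_both {Δ : Set Formula} (h : MCS Δ) {x : ℕ} {t : Term} {φ : Formula}
    (h1 : Formula.assign x t φ ∈ Δ) (h2 : Formula.assign x t φ.neg ∈ Δ) : False := by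
  have h3 : Provable (φ.imp (φ.neg.imp Formula.top.neg)) := .taut fun v hn ha => by
    rw [v_imp hn ha, v_imp hn ha, hn]; tauto
  have h4 := h.mp (h.use (.kAS _ _ _ _) (h.use (assign_mono x t h3) h1)) h2
  exact (h.neg _).1 (h.thm (.dAS x t)) h4

theorem exists_witness {V : Set ℕ} {Δ : Set Formula} (h : MCS Δ) {y : ℕ} (hy : y ∉ V) (t : Term)
    (hyt : y ∉ t.vars) :
    ∃ Θ, MCS Θ ∧ EqOn V Θ Δ ∧ Formula.eq (.var y) t ∈ Θ := by
  obtain ⟨Θ, h1, h2, h3⟩ := lindenbaum_union (A := {ψ | ψ ∈ Δ ∧ Lang V ψ})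
    (B := {Formula.eq (.var y) t}) (by
    intro l l' hl hl' hp
    have hlang : Lang V (Formula.conjList l) := lang_conj fun ψ hψ => (hl ψ hψ).2
    have h1 : Provable ((Formula.conjList l).imp (Formula.eq (.var y) t).neg) :=
      .taut1 hp fun v hn ha => by
        rw [v_imp hn ha, v_imp hn ha, hn, hn, v_conj hn ha, v_conj hn ha]
        intro h1 h2 h3
        exact h1 h2 fun ψ hψ => by rw [hl' ψ hψ]; exact h3
    have h2 := Provable.necAS y t (fun hc => hy (hlang y hc)) h1
    exact h.not_both (h.thm (.efAS y t)) (h.use h2 ((h.conj _).2 fun ψ hψ => (hl ψ hψ).1)))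
  exact ⟨Θ, h3, eqOn_of h3 h h1, h2 rfl⟩

theorem eqOn_refl (V : Set ℕ) (Δ : Set Formula) : EqOn V Δ Δ := fun _ _ => Iff.rfl

theorem agree_symm {x : ℕ} {Δ Δ' : Set Formula} (h : Agree x Δ Δ') : Agree x Δ' Δ :=
  fun ψ => (h ψ).symm

theorem extend (V : Set ℕ) (par lab : ℕ → ℕ) (hpar : ∀ j, 0 < j → par j < j) :
    ∀ k, (∀ j, j < k → lab j ∈ V) → ∀ Δ : ℕ → Set Formula, (∀ n, MCS (Δ n)) →
    (∀ j, 0 < j → j < k → Agree (lab j) (Δ (par j)) (Δ j)) →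
    ∀ r, r < k → ∀ Θ, MCS Θ → EqOn V Θ (Δ r) →
    ∃ Δ' : ℕ → Set Formula, (∀ n, MCS (Δ' n)) ∧ Δ' r = Θ ∧ (∀ n, EqOn V (Δ' n) (Δ n)) ∧
      ∀ j, 0 < j → j < k → Agree (lab j) (Δ' (par j)) (Δ' j) := by
  intro k
  induction k with
  | zero => intro _ _ _ _ r hr; omega
  | succ k ih =>
    intro hlab Δ hM hA r hr Θ hΘ he
    -- it suffices to find a family which is good below `k` and a good set for `k`
    have fin : ∀ (Δ' : ℕ → Set Formula) (Θk : Set Formula), (∀ n, MCS (Δ' n)) → MCS Θk →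
        (∀ n, EqOn V (Δ' n) (Δ n)) → EqOn V Θk (Δ k) →
        (∀ j, 0 < j → j < k → Agree (lab j) (Δ' (par j)) (Δ' j)) →
        (0 < k → Agree (lab k) (Δ' (par k)) Θk) → (r = k → Θk = Θ) → (r < k → Δ' r = Θ) →
        ∃ Δ' : ℕ → Set Formula, (∀ n, MCS (Δ' n)) ∧ Δ' r = Θ ∧ (∀ n, EqOn V (Δ' n) (Δ n)) ∧
          ∀ j, 0 < j → j < k + 1 → Agree (lab j) (Δ' (par j)) (Δ' j) := by
      intro Δ' Θk h1 h2 h3 h4 h5 h6 h7 h8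
      refine ⟨fun n => if n = k then Θk else Δ' n, ?_, ?_, ?_, ?_⟩
      · intro n; by_cases h : n = k <;> simp [h, h1, h2]
      · by_cases h : r = k
        · simp [h, h7 h]
        · simp [h, h8 (by omega)]
      · intro n
        by_cases h : n = k
        · subst h; simpa using h4
        · simpa [h] using h3 n
      · intro j hj hjk
        have hp := hpar j hj
        have hpk : par j ≠ k := by omega
        by_cases h : j = k
        · subst h; simpa [hpk] using h6 hj
        · simpa [hpk, h] using h5 j hj (by omega)
    have hA' : ∀ j, 0 < j → j < k → Agree (lab j) (Δ (par j)) (Δ j) :=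
      fun j hj hjk => hA j hj (by omega)
    have hlab' : ∀ j, j < k → lab j ∈ V := fun j hj => hlab j (by omega)
    rcases Nat.lt_succ_iff_lt_or_eq.1 hr with hrk | rfl
    · obtain ⟨Δ', h1, h2, h3, h4⟩ := ih hlab' Δ hM hA' r hrk Θ hΘ he
      obtain ⟨Θk, h5, h6, h7⟩ := neighbour (hlab k (by omega)) (hM (par k)) (hM k) (h1 (par k))
        (hA k (by omega) (by omega)) (h3 (par k))
      exact fin Δ' Θk h1 h5 h3 h7 h4 (fun _ => h6) (by omega) (fun _ => h2)
    · rcases Nat.eq_zero_or_pos r with rfl | hpos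
      · exact fin Δ Θ hM hΘ (fun n => eqOn_refl _ _) he (by omega) (by omega) (fun _ => rfl) (by omega)
      · obtain ⟨Θp, h5, h6, h7⟩ := neighbour (hlab r (by omega)) (hM r) (hM (par r)) hΘ
          (agree_symm (hA r hpos (by omega))) he
        obtain ⟨Δ', h1, h2, h3, h4⟩ := ih hlab' Δ hM hA' (par r) (hpar r hpos) Θp h5 h7
        exact fin Δ' Θ h1 hΘ h3 he h4 (fun _ => by rw [h2]; exact agree_symm h6) (fun _ => rfl)
          (by omega)

/-! ### The stages of the construction -/

def VV (k : ℕ) : Set ℕ := {v | v % 2 = 0 ∨ v < 2 * k + 1}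

theorem VV_mono {k k' : ℕ} (h : k ≤ k') {v : ℕ} (hv : v ∈ VV k) : v ∈ VV k' := by
  simp only [VV, Set.mem_ofPred_eq] at *; omega

theorem lang_mono {k k' : ℕ} (h : k ≤ k') {φ : Formula} (hv : Lang (VV k) φ) : Lang (VV k') φ :=
  fun x hx => VV_mono h (hv x hx)

theorem exists_lang (φ : Formula) : ∃ k, Lang (VV k) φ :=
  ⟨φ.fv.sup id, fun x hx => Or.inr (by
    have : x ≤ φ.fv.sup id := Finset.le_sup (f := id) hx
    omega)⟩

def Good (par lab : ℕ → ℕ) (k : ℕ) (Δ : ℕ → Set Formula) : Prop :=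
  (∀ n, MCS (Δ n)) ∧ ∀ j, 0 < j → j < k → Agree (lab j) (Δ (par j)) (Δ j)

theorem step (par lab : ℕ → ℕ) (hpar : ∀ j, 0 < j → par j < j) (hlab : ∀ j, lab j ∈ VV j)
    (k : ℕ) (hk : 0 < k) (t : Term) (ht : 2 * k + 1 ∉ t.vars) (φ : Formula)
    (Δ : ℕ → Set Formula) (hg : Good par lab k Δ) :
    ∃ Δ', Good par lab (k + 1) Δ' ∧ (∀ n, n < k → EqOn (VV k) (Δ' n) (Δ n)) ∧
      Formula.eq (.var (2 * k + 1)) t ∈ Δ' (par k) ∧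
      ((Formula.know (.var (lab k)) φ).neg ∈ Δ' (par k) → φ.neg ∈ Δ' k) := by
  obtain ⟨Θ, h1, h2, h3⟩ := exists_witness (V := VV k) (y := 2 * k + 1) (hg.1 (par k))
    (by simp only [VV, Set.mem_ofPred_eq]; omega) t ht
  obtain ⟨Δ', h4, h5, h6, h7⟩ := extend (VV k) par lab hpar k
    (fun j hj => VV_mono (by omega) (hlab j)) Δ hg.1 hg.2 (par k) (hpar k hk) Θ h1 h2
  obtain ⟨Θ', h8, h9, h10⟩ := child (x := lab k) (φ := φ) (h4 (par k))
  have hpk := hpar k hk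
  refine ⟨fun n => if n = k then Θ' else Δ' n, ⟨?_, ?_⟩, ?_, ?_, ?_⟩
  · intro n; by_cases h : n = k <;> simp [h, h4, h8]
  · intro j hj hjk
    have hp := hpar j hj
    have hpk : par j ≠ k := by omega
    by_cases h : j = k
    · subst h; simpa [hpk] using h9
    · simpa [hpk, h] using h7 j hj (by omega)
  · intro n hn
    have : n ≠ k := by omega
    simpa [this] using h6 n
  · simpa [hpk.ne, h5] using h3
  · simpa [hpk.ne] using h10

/-- The limit network. -/
structure Network (D : ℕ → Set Formula) : Prop where
  mcs : ∀ n, MCS (D n)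
  rigid : ∀ n x y, Formula.eq (.var x) (.var y) ∈ D n ↔ Formula.eq (.var x) (.var y) ∈ D 0
  wit : ∀ n t B, ∃ y, B ≤ y ∧ Formula.eq (.var y) t ∈ D n
  succ : ∀ n x φ, (Formula.know (.var x) φ).neg ∈ D n → ∃ m, Agree x (D n) (D m) ∧ φ.neg ∈ D m

theorem rigid_agree {Δ Δ' : Set Formula} (h : MCS Δ) (h' : MCS Δ') {z : ℕ} (ha : Agree z Δ Δ')
    (x y : ℕ) : Formula.eq (.var x) (.var y) ∈ Δ ↔ Formula.eq (.var x) (.var y) ∈ Δ' :=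
  ⟨fun h1 => h'.use (.tx z _) ((ha _).1 (h.use (.rigidP x y _) h1)),
    fun h1 => h.use (.tx z _) ((ha _).2 (h'.use (.rigidP x y _) h1))⟩

theorem exists_network (Δ₀ : Set Formula) (h₀ : MCS Δ₀) :
    ∃ D, Network D ∧ ∀ φ ∈ Δ₀, Lang (VV 0) φ → φ ∈ D 0 := by
  classical
  obtain ⟨e, he⟩ := exists_tasks
  let par : ℕ → ℕ := fun k => if (e k).1 < k then (e k).1 else 0
  let tm : ℕ → Term := fun k => if 2 * k + 1 ∈ (e k).2.1.vars then .name 0 else (e k).2.1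
  let lab : ℕ → ℕ := fun k => if (e k).2.2.1 ∈ VV k then (e k).2.2.1 else 0
  let fm : ℕ → Formula := fun k => (e k).2.2.2
  have hpar : ∀ j, 0 < j → par j < j := by
    intro j hj; simp only [par]; split <;> omega
  have hlab : ∀ j, lab j ∈ VV j := by
    intro j; simp only [lab]; split
    · assumption
    · simp [VV]
  have htm : ∀ k, 2 * k + 1 ∉ (tm k).vars := by
    intro k; simp only [tm]; split
    · simp [Term.vars]
    · assumption
  have hstep := fun k Δ hg => step par lab hpar hlab (k + 1) (by omega) (tm (k + 1)) (htm _)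
    (fm (k + 1)) Δ hg
  choose nxt hn1 hn2 hn3 hn4 using hstep
  let S : ∀ k, {Δ : ℕ → Set Formula // Good par lab (k + 1) Δ} := fun k =>
    Nat.rec ⟨fun _ => Δ₀, fun _ => h₀, fun j h1 h2 => absurd h2 (Nat.not_lt.2 h1)⟩ (fun k Δ => ⟨nxt k Δ.1 Δ.2, hn1 k _ _⟩) k
  have hS : ∀ k, (S (k + 1)).1 = nxt k (S k).1 (S k).2 := fun k => rfl
  have stab : ∀ k k', k ≤ k' → ∀ n, n ≤ k → EqOn (VV (k + 1)) ((S k').1 n) ((S k).1 n) := by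
    intro k k' hkk'
    induction k', hkk' using Nat.le_induction with
    | base => intro n _; exact eqOn_refl _ _
    | succ k' hk' ih =>
      intro n hn φ hφ
      rw [hS, hn2 k' _ _ n (by omega) φ (lang_mono (by omega) hφ)]
      exact ih n hn φ hφ
  let D : ℕ → Set Formula := fun n => {φ | ∃ k, n ≤ k ∧ Lang (VV (k + 1)) φ ∧ φ ∈ (S k).1 n}
  have hD : ∀ n k φ, n ≤ k → Lang (VV (k + 1)) φ → (φ ∈ D n ↔ φ ∈ (S k).1 n) := by
    intro n k φ hnk hφ
    constructor
    · rintro ⟨k', h1, h2, h3⟩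
      rcases le_total k k' with h | h
      · exact (stab k k' h n hnk φ hφ).1 h3
      · exact (stab k' k h n h1 φ h2).2 h3
    · intro h
      exact ⟨k, hnk, hφ, h⟩
  have hmcs : ∀ n, MCS (D n) := by
    intro n
    refine ⟨fun {φ} hp => ?_, fun {φ ψ} h1 h2 => ?_, fun φ => ?_⟩
    · obtain ⟨k, hk⟩ := exists_lang φ
      rw [hD n (max n k) φ (by omega) (lang_mono (by omega) hk)]
      exact ((S _).2.1 n).thm hp
    · obtain ⟨k, hk⟩ := exists_lang (φ.imp ψ)
      have hL : Lang (VV (max n k + 1)) (φ.imp ψ) := lang_mono (by omega) hk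
      rw [hD n (max n k) _ (by omega) hL] at h1
      rw [hD n (max n k) _ (by omega) fun x hx => hL x (by simp [Formula.imp, Formula.fv, hx])]
        at h2 ⊢
      exact ((S _).2.1 n).mp h1 h2
    · obtain ⟨k, hk⟩ := exists_lang φ
      have hL : Lang (VV (max n k + 1)) φ := lang_mono (by omega) hk
      rw [hD n (max n k) φ (by omega) hL, hD n (max n k) φ.neg (by omega) hL]
      exact ((S _).2.1 n).neg φ
  refine ⟨D, ⟨hmcs, ?_, ?_, ?_⟩, ?_⟩
  · intro n x y
    induction n using Nat.strong_induction_on with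
    | _ n ih =>
      rcases Nat.eq_zero_or_pos n with rfl | hpos
      · rfl
      · rw [← ih (par n) (hpar n hpos)]
        obtain ⟨k, hk⟩ := exists_lang (Formula.eq (.var x) (.var y))
        have hL : Lang (VV (max n k + 1)) (Formula.eq (.var x) (.var y)) :=
          lang_mono (by omega) hk
        have := hpar n hpos
        rw [hD n (max n k) _ (by omega) hL, hD (par n) (max n k) _ (by omega) hL]
        exact (rigid_agree ((S _).2.1 _) ((S _).2.1 _)
          ((S (max n k)).2.2 n hpos (by omega)) x y).symm
  · intro n t B
    obtain ⟨C, hC⟩ : ∃ C, ∀ x ∈ t.vars, x < C := ⟨t.vars.sup id + 1, fun x hx => by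
      have : x ≤ t.vars.sup id := Finset.le_sup (f := id) hx
      omega⟩
    obtain ⟨k, hk, hek⟩ := he (n, t, 0, Formula.top) (n + B + C + 1)
    obtain ⟨k, rfl⟩ : ∃ j, k = j + 1 := ⟨k - 1, by omega⟩
    have h1 : par (k + 1) = n := by
      simp only [par, hek]; rw [if_pos (by omega)]
    have h2 : tm (k + 1) = t := by
      simp only [tm, hek]
      rw [if_neg]
      intro h
      have := hC _ h
      omega
    have h3 := hn3 k (S k).1 (S k).2
    rw [h1, h2, ← hS] at h3
    refine ⟨2 * (k + 1) + 1, by omega, (hD n (k + 1) _ (by omega) ?_).2 h3⟩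
    intro x hx
    simp only [Formula.fv, Finset.mem_union] at hx
    right
    rcases hx with hx | hx
    · simp only [Term.vars, Finset.mem_singleton] at hx; omega
    · have := hC _ hx
      omega
  · intro n x φ hφ
    obtain ⟨C, hC⟩ := exists_lang (Formula.know (.var x) φ).neg
    obtain ⟨k, hk, hek⟩ := he (n, .name 0, x, φ) (n + C + 1)
    obtain ⟨k, rfl⟩ : ∃ j, k = j + 1 := ⟨k - 1, by omega⟩
    have h1 : par (k + 1) = n := by
      simp only [par, hek]; rw [if_pos (by omega)]
    have h2 : lab (k + 1) = x := by
      simp only [lab, hek]; rw [if_pos]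
      exact VV_mono (by omega) (hC x (by simp [Formula.fv, Term.vars]))
    have h3 : fm (k + 1) = φ := by simp only [fm, hek]
    have h4 := hn4 k (S k).1 (S k).2
    rw [h1, h2, h3, ← hS] at h4
    have hL : Lang (VV (k + 1 + 1)) (Formula.know (.var x) φ).neg := lang_mono (by omega) hC
    refine ⟨k + 1, ?_, ?_⟩
    · intro ψ
      obtain ⟨C', hC'⟩ := exists_lang (Formula.know (.var x) ψ)
      have hL' : Lang (VV (max (k + 1) C' + 1)) (Formula.know (.var x) ψ) :=
        lang_mono (by omega) hC'
      rw [hD n (max (k + 1) C') _ (by omega) hL', hD (k + 1) (max (k + 1) C') _ (by omega) hL']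
      have := (S (max (k + 1) C')).2.2 (k + 1) (by omega) (by omega) ψ
      rwa [h1, h2] at this
    · rw [hD (k + 1) (k + 1) _ le_rfl fun z hz => hL z (by
        simp only [Formula.fv, Finset.mem_union] at hz ⊢; exact Or.inr hz)]
      exact h4 ((hD n (k + 1) _ (by omega) hL).1 hφ)
  · intro φ hφ hL
    exact ⟨0, le_rfl, lang_mono (by omega) hL, hφ⟩

/-! ### The canonical model and the truth lemma -/

def Formula.size : Formula → ℕ
  | .eq _ _ => 0
  | .pred _ _ => 0
  | .neg φ => φ.size + 1
  | .and φ ψ => φ.size + ψ.size + 1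
  | .know _ φ => φ.size + 1
  | .assign _ _ φ => φ.size + 1

theorem Formula.size_subst (φ : Formula) (x y : ℕ) : (φ.subst x y).size = φ.size := by
  induction φ with
  | assign z t φ ih => simp only [Formula.subst]; split <;> simp [Formula.size, ih]
  | _ => simp_all [Formula.subst, Formula.size]

theorem den_subst (M : Model) (w : M.W) (σ : ℕ → M.I) (t : Term) (x y : ℕ) :
    M.den w σ (t.subst x y) = M.den w (Function.update σ x (σ y)) t := by
  cases t with
  | var z =>
    by_cases h : z = x
    · subst h; simp [Term.subst, Model.den]
    · simp [Term.subst, Model.den, h]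
  | name a => rfl

theorem fresh_subst (M : Model) (φ : Formula) (x : ℕ) : ∃ B, ∀ y, B ≤ y → φ.admissible x y ∧
    ∀ w σ, (M.Sat (φ.subst x y) w σ ↔ M.Sat φ w (Function.update σ x (σ y))) := by
  induction φ with
  | eq t t' => exact ⟨0, fun y _ => ⟨trivial, fun w σ => by
      simp [Formula.subst, Model.Sat, den_subst]⟩⟩
  | pred P ts =>
    refine ⟨0, fun y _ => ⟨trivial, fun w σ => ?_⟩⟩
    simp only [Formula.subst, Model.Sat, List.map_map]
    have : (M.den w σ ∘ fun t => t.subst x y) = M.den w (Function.update σ x (σ y)) :=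
      funext fun t => den_subst M w σ t x y
    rw [this]
  | neg φ ih =>
    obtain ⟨B, hB⟩ := ih
    exact ⟨B, fun y hy => ⟨(hB y hy).1, fun w σ => not_congr ((hB y hy).2 w σ)⟩⟩
  | and φ ψ ih1 ih2 =>
    obtain ⟨B, hB⟩ := ih1
    obtain ⟨B', hB'⟩ := ih2
    refine ⟨max B B', fun y hy => ⟨⟨(hB y (by omega)).1, (hB' y (by omega)).1⟩, fun w σ => ?_⟩⟩
    exact and_congr ((hB y (by omega)).2 w σ) ((hB' y (by omega)).2 w σ)
  | know t φ ih =>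
    obtain ⟨B, hB⟩ := ih
    refine ⟨B, fun y hy => ⟨(hB y hy).1, fun w σ => ?_⟩⟩
    simp only [Formula.subst, Model.Sat, den_subst]
    exact forall_congr' fun v => imp_congr_right fun _ => (hB y hy).2 v σ
  | assign z t φ ih =>
    obtain ⟨B, hB⟩ := ih
    refine ⟨max B (z + 1), fun y hy => ?_⟩
    have hzy : z ≠ y := by omega
    refine ⟨Or.inr ⟨fun _ => hzy, (hB y (by omega)).1⟩, fun w σ => ?_⟩
    by_cases hzx : z = x
    · subst hzx
      simp [Formula.subst, Model.Sat, den_subst]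
    · simp only [Formula.subst, if_neg hzx, Model.Sat, den_subst]
      rw [(hB y (by omega)).2, Function.update_of_ne hzy.symm, Function.update_comm hzx]

theorem Network.eqv {D : ℕ → Set Formula} (h : Network D) :
    Equivalence (fun x y : ℕ => Formula.eq (.var x) (.var y) ∈ D 0) :=
  ⟨fun x => (h.mcs 0).refl _, fun h1 => (h.mcs 0).symm h1, fun h1 h2 => (h.mcs 0).trans h1 h2⟩

def Network.setoid {D : ℕ → Set Formula} (h : Network D) : Setoid ℕ := ⟨_, h.eqv⟩

noncomputable def Network.model {D : ℕ → Set Formula} (h : Network D) : Model where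
  W := ℕ
  I := Quotient h.setoid
  wNE := ⟨0⟩
  iNE := ⟨Quotient.mk h.setoid 0⟩
  R := fun i n m => ∀ x, Quotient.mk h.setoid x = i → Agree x (D n) (D m)
  ρ := fun P n is => ∃ xs : List ℕ, is = xs.map (Quotient.mk h.setoid) ∧
    Formula.pred P (xs.map Term.var) ∈ D n
  η := fun a n => Quotient.mk h.setoid (h.wit n (.name a) 0).choose

def Network.cls {D : ℕ → Set Formula} (h : Network D) : ℕ → h.model.I :=
  fun x => Quotient.mk h.setoid x

theorem Network.epistemic {D : ℕ → Set Formula} (h : Network D) : h.model.Epistemic := fun i =>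
  ⟨fun n x _ ψ => Iff.rfl, fun h1 x hx => agree_symm (h1 x hx),
    fun h1 h2 x hx ψ => (h1 x hx ψ).trans (h2 x hx ψ)⟩

theorem Network.mk_eq {D : ℕ → Set Formula} (h : Network D) (n x y : ℕ) :
    h.cls x = h.cls y ↔ Formula.eq (.var x) (.var y) ∈ D n := by
  rw [h.rigid n]
  exact Quotient.eq (r := h.setoid)

theorem Network.den_eq {D : ℕ → Set Formula} (h : Network D) (n y : ℕ) (t : Term) :
    h.cls y = h.model.den n h.cls t ↔
      Formula.eq (.var y) t ∈ D n := by
  cases t with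
  | var x => exact h.mk_eq n y x
  | name a =>
    have h1 := (h.wit n (.name a) 0).choose_spec.2
    refine (h.mk_eq n _ _).trans ⟨fun h2 => ?_, fun h2 => ?_⟩
    · exact (h.mcs n).trans h2 h1
    · exact (h.mcs n).trans h2 ((h.mcs n).symm h1)

theorem Network.pred_iff {D : ℕ → Set Formula} (h : Network D) (n P : ℕ) (xs : List ℕ)
    (ts : List Term) (he : xs.map h.cls =
      ts.map (h.model.den n h.cls)) :
    Formula.pred P (xs.map Term.var) ∈ D n ↔ Formula.pred P ts ∈ D n := by
  have hlen : xs.length = ts.length := by simpa using congrArg List.length he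
  refine ((h.mcs n).iff _ _).1 ((h.mcs n).use (.subP P (xs.map Term.var) ts (by simpa using hlen)) ?_)
  rw [(h.mcs n).conj]
  clear hlen
  induction xs generalizing ts with
  | nil => simp
  | cons x xs ih =>
    cases ts with
    | nil => simp
    | cons t ts =>
      simp only [List.map_cons, List.cons.injEq] at he
      simp only [List.map_cons, List.zipWith_cons_cons, List.mem_cons, forall_eq_or_imp]
      exact ⟨(h.den_eq n x t).1 he.1, ih ts he.2⟩

theorem Network.truth {D : ℕ → Set Formula} (h : Network D) : ∀ (s : ℕ) (φ : Formula),
    φ.size = s → ∀ n : ℕ, h.model.Sat φ n h.cls ↔ φ ∈ D n := by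
  intro s
  induction s using Nat.strong_induction_on with
  | _ s ih =>
    intro φ hs n
    cases φ with
    | eq t t' =>
      obtain ⟨y, -, hy⟩ := h.wit n t 0
      have h1 := (h.den_eq n y t).2 hy
      simp only [Model.Sat]
      rw [← h1, h.den_eq n y t']
      exact (h.mcs n).eq_congr hy ((h.mcs n).refl _)
    | pred P ts =>
      constructor
      · rintro ⟨xs, h1, h2⟩
        exact (h.pred_iff n P xs ts h1.symm).1 h2
      · intro h1
        choose y hy using fun t => h.wit n t 0
        have h3 : (ts.map y).map h.cls =
            ts.map (h.model.den n h.cls) := by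
          rw [List.map_map]
          exact List.map_congr_left fun t _ => (h.den_eq n (y t) t).2 (hy t).2
        exact ⟨ts.map y, h3.symm, (h.pred_iff n P _ ts h3).2 h1⟩
    | neg φ =>
      simp only [Formula.size] at hs
      rw [(h.mcs n).neg, ← ih φ.size (by omega) φ rfl n]
      rfl
    | and φ ψ =>
      simp only [Formula.size] at hs
      rw [(h.mcs n).and, ← ih φ.size (by omega) φ rfl n, ← ih ψ.size (by omega) ψ rfl n]
      rfl
    | know t φ =>
      simp only [Formula.size] at hs
      obtain ⟨y, -, hy⟩ := h.wit n t 0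
      rw [← (h.mcs n).know_congr hy]
      have h1 := (h.den_eq n y t).2 hy
      simp only [Model.Sat]
      rw [← h1]
      constructor
      · intro h2
        by_contra h3
        obtain ⟨m, h4, h5⟩ := h.succ n y φ (((h.mcs n).neg _).2 h3)
        refine ((h.mcs m).neg _).1 h5 ((ih φ.size (by omega) φ rfl m).1 (h2 m ?_))
        intro x hx ψ
        rw [(h.mcs n).know_congr ((h.mk_eq n x y).1 hx),
          (h.mcs m).know_congr ((h.mk_eq m x y).1 hx)]
        exact h4 ψ
      · intro h2 m hm
        exact (ih φ.size (by omega) φ rfl m).2 ((h.mcs m).use (.tx y φ) ((hm y rfl φ).1 h2))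
    | assign x t φ =>
      simp only [Formula.size] at hs
      obtain ⟨B, hB⟩ := fresh_subst h.model φ x
      obtain ⟨y, hBy, hy⟩ := h.wit n t B
      obtain ⟨hadm, hsub⟩ := hB y hBy
      rw [← (h.mcs n).assign_congr hy]
      have h1 := (h.den_eq n y t).2 hy
      simp only [Model.Sat]
      rw [← h1]
      refine (hsub n h.cls).symm.trans ?_
      rw [ih φ.size (by omega) (φ.subst x y) (Formula.size_subst φ x y) n]
      constructor
      · exact fun h2 => (h.mcs n).use (.sub2AS x y φ hadm) h2
      · intro h2
        by_contra h3
        have h4 : (φ.neg).subst x y ∈ D n := ((h.mcs n).neg _).2 h3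
        exact (h.mcs n).not_both h2 ((h.mcs n).use (.sub2AS x y φ.neg hadm) h4)

theorem Term.even_rename (t : Term) : ∀ x ∈ (t.rename (fun x => 2 * x)).vars, x % 2 = 0 := by
  cases t <;> simp [Term.rename, Term.vars]

theorem Formula.even_rename (φ : Formula) :
    ∀ x ∈ (φ.rename (fun x => 2 * x)).fv, x % 2 = 0 := by
  induction φ with
  | eq t t' =>
    intro x hx
    rcases Finset.mem_union.1 hx with h | h
    · exact t.even_rename x h
    · exact t'.even_rename x h
  | pred P ts =>
    intro x hx
    rw [Formula.rename, mem_fv_pred] at hx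
    obtain ⟨t, ht, hx⟩ := hx
    obtain ⟨t', -, rfl⟩ := List.mem_map.1 ht
    exact t'.even_rename x hx
  | neg φ ih => exact ih
  | and φ ψ ih1 ih2 =>
    intro x hx
    rcases Finset.mem_union.1 hx with h | h
    · exact ih1 x h
    · exact ih2 x h
  | know t φ ih =>
    intro x hx
    rcases Finset.mem_union.1 hx with h | h
    · exact t.even_rename x h
    · exact ih x h
  | assign z t φ ih =>
    intro x hx
    rcases Finset.mem_union.1 hx with h | h
    · exact ih x (Finset.mem_of_mem_erase h)
    · exact t.even_rename x h

theorem strong_completeness (Γ : Set Formula) (hΓ : ConsistentSet Γ) :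
    ∃ M : Model, M.Epistemic ∧ ∃ (w : M.W) (σ : ℕ → M.I), ∀ φ ∈ Γ, M.Sat φ w σ := by
  obtain ⟨Δ, h1, h2⟩ := lindenbaum (consistent_rename hΓ)
  obtain ⟨D, hD, h3⟩ := exists_network Δ h2
  refine ⟨hD.model, hD.epistemic, (0 : ℕ), hD.cls ∘ (fun x => 2 * x), ?_⟩
  intro φ hφ
  have hf : Function.Injective (fun x : ℕ => 2 * x) := fun a b h => by
    simp only at h; omega
  refine (sat_rename hD.model hf φ (0 : ℕ) hD.cls).1 ?_
  refine (hD.truth _ _ rfl 0).2 (h3 _ (h1 ⟨φ, hφ, rfl⟩) ?_)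
  exact fun x hx => Or.inl (φ.even_rename x hx)

end ELAS

/-- strong completeness of SELAS over epistemic models: every
    SELAS-consistent set of formulas is satisfiable in an epistemic model with
    an assignment; in particular every formula valid over epistemic models is
    derivable in SELAS. -/
theorem stmt18 :
    (∀ Γ : Set Formula, ConsistentSet Γ →
      ∃ M : Model, M.Epistemic ∧
        ∃ (w : M.W) (σ : ℕ → M.I), ∀ φ ∈ Γ, M.Sat φ w σ) ∧
    (∀ φ : Formula,
      (∀ (M : Model), M.Epistemic → ∀ (w : M.W) (σ : ℕ → M.I), M.Sat φ w σ) →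
      Provable φ) := by
  refine ⟨fun Γ hΓ => ELAS.strong_completeness Γ hΓ, fun φ hval => ?_⟩
  by_contra hφ
  have hc : ConsistentSet {Formula.neg φ} := by
    rintro ⟨l, hl, hp⟩
    refine hφ (.taut1 hp fun v hn ha hv => ?_)
    rw [hn, v_conj hn ha] at hv
    by_contra h1
    exact hv fun ψ hψ => by rw [hl ψ hψ, hn]; exact h1
  obtain ⟨M, hM, w, σ, hs⟩ := ELAS.strong_completeness _ hc
  exact hs _ rfl (hval M hM w σ)
end
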